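/- arXiv:1312.7233 — 5 statements merged into one kernel-verified Lean document; each statement's English description precedes it below -/
import Mathlib

section
/- If T is a tree in 𝒯₃ with n ≥ 30 vertices, then there exists an internal vertex v of T such that |μ(T) − λ(T,v)| < 2. -/
open SimpleGraph Finset BigOperators Filter

attribute [local instance] Classical.propDecidable

/-- A finset of vertices induces a subtree of `G`: it is nonempty and its induced
subgraph is connected. -/
def SimpleGraph.IsSubtree {V : Type*} (G : SimpleGraph V) (s : Finset V) : Prop :=
  s.Nonempty ∧ (G.induce (s : Set V)).Connected

/-- The collection of all subtrees of `G` (as finsets of vertices). -/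
noncomputable def subtreeFinset {V : Type*} [Fintype V] (G : SimpleGraph V) :
    Finset (Finset V) :=
  Finset.univ.filter G.IsSubtree

/-- `μ(G)`: the average order (number of vertices) of a subtree of `G`. -/
noncomputable def mu {V : Type*} [Fintype V] (G : SimpleGraph V) : ℚ :=
  (∑ s ∈ subtreeFinset G, (s.card : ℚ)) / ((subtreeFinset G).card : ℚ)

/-- `G` is in the class 𝒯₃: a tree with at least one internal vertex (a vertex of
degree at least 2) in which every internal vertex has degree at least 3. -/
noncomputable def InT3 {V : Type*} [Fintype V] (G : SimpleGraph V) : Prop :=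
  G.IsTree ∧ (∃ v, 2 ≤ G.degree v) ∧ ∀ v, 2 ≤ G.degree v → 3 ≤ G.degree v

/-- `λ(G,v)`: the average order of the subtrees of `G` containing the vertex `v`. -/
noncomputable def lambdaV {V : Type*} [Fintype V] (G : SimpleGraph V) (v : V) : ℚ :=
  (∑ s ∈ (subtreeFinset G).filter (fun s => v ∈ s), (s.card : ℚ)) /
    (((subtreeFinset G).filter (fun s => v ∈ s)).card : ℚ)

/-- The subtrees of `G` that contain `u` and avoid `w`. -/
noncomputable def cutSubtrees {V : Type*} [Fintype V] (G : SimpleGraph V) (u w : V) :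
    Finset (Finset V) :=
  (subtreeFinset G).filter (fun s => u ∈ s ∧ w ∉ s)

/-- The subtrees of `G` that contain `v`. -/
noncomputable def subtreesThrough {V : Type*} [Fintype V] (G : SimpleGraph V) (v : V) :
    Finset (Finset V) :=
  (subtreeFinset G).filter (fun s => v ∈ s)

section Subtrees

variable {V : Type*} {G : SimpleGraph V}

theorem SimpleGraph.IsSubtree.union_of_adj {s t : Finset V} {a b : V} (hs : G.IsSubtree s)
    (ht : G.IsSubtree t) (ha : a ∈ s) (hb : b ∈ t) (hab : G.Adj a b) :
    G.IsSubtree (s ∪ t) := by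
  refine ⟨hs.1.mono Finset.subset_union_left, ?_⟩
  rw [Finset.coe_union]
  exact connected_induce_union hs.2.preconnected ht.2.preconnected (Finset.mem_coe.2 ha)
    (Finset.mem_coe.2 hb) hab

theorem isSubtree_singleton (a : V) : G.IsSubtree {a} := by
  refine ⟨Finset.singleton_nonempty a, ?_⟩
  rw [Finset.coe_singleton, SimpleGraph.connected_iff]
  exact ⟨Preconnected.of_subsingleton, ⟨⟨a, rfl⟩⟩⟩

theorem SimpleGraph.IsSubtree.insert_of_adj {s : Finset V} {a b : V} (hs : G.IsSubtree s)
    (ha : a ∈ s) (hab : G.Adj a b) : G.IsSubtree (insert b s) := by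
  have := hs.union_of_adj (isSubtree_singleton b) ha (Finset.mem_singleton_self b) hab
  rwa [Finset.union_comm, ← Finset.insert_eq] at this

/-- In a forest, subtrees on the two sides of an edge are disjoint. -/
theorem SimpleGraph.IsSubtree.disjoint_of_adj {s t : Finset V} {a b : V} (hG : G.IsAcyclic)
    (hs : G.IsSubtree s) (ht : G.IsSubtree t) (hab : G.Adj a b) (has : a ∈ s) (hbs : b ∉ s)
    (hbt : b ∈ t) (hat : a ∉ t) : Disjoint s t := by
  have reach : ∀ r : Finset V, G.IsSubtree r → (a ∉ r ∨ b ∉ r) → ∀ x ∈ r, ∀ y ∈ r,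
      (G.deleteEdges {s(a, b)}).Reachable x y := by
    intro r hr hn x hx y hy
    let f : G.induce (r : Set V) →g G.deleteEdges {s(a, b)} :=
      ⟨Subtype.val, by
        rintro ⟨p, hp⟩ ⟨q, hq⟩ hpq
        rw [deleteEdges_adj]
        refine ⟨hpq, ?_⟩
        have hp' : p ∈ r := hp
        have hq' : q ∈ r := hq
        simp only [Set.mem_singleton_iff, Sym2.eq_iff]
        rintro (⟨rfl, rfl⟩ | ⟨rfl, rfl⟩) <;> tauto⟩
    exact (hr.2.preconnected ⟨x, hx⟩ ⟨y, hy⟩).map f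
  rw [Finset.disjoint_left]
  intro x hxs hxt
  exact isBridge_iff.1 (isAcyclic_iff_forall_adj_isBridge.1 hG hab)
    ((reach s hs (Or.inr hbs) a has x hxs).trans (reach t ht (Or.inl hat) x hxt b hbt))

/-- In a forest, a subtree avoiding `w` contains at most one neighbour of `w`. -/
theorem SimpleGraph.IsSubtree.eq_of_adj_of_adj {s : Finset V} {w a b : V} (hG : G.IsAcyclic)
    (hs : G.IsSubtree s) (hw : w ∉ s) (ha : a ∈ s) (hb : b ∈ s) (hwa : G.Adj w a)
    (hwb : G.Adj w b) : a = b := by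
  by_contra hne
  have ht : G.IsSubtree (insert w {b}) :=
    (isSubtree_singleton b).insert_of_adj (Finset.mem_singleton_self b) hwb.symm
  have hd := hs.disjoint_of_adj hG ht hwa.symm ha hw (Finset.mem_insert_self _ _)
    (by simp [hwa.ne', hne])
  exact Finset.disjoint_left.1 hd hb (by simp)

/-- In a connected graph, every vertex other than `v` has a neighbour closer to `v`. -/
theorem exists_adj_dist_lt (hG : G.Connected) {u v : V} (huv : u ≠ v) :
    ∃ w, G.Adj u w ∧ G.dist w v < G.dist u v := by
  obtain ⟨p, hp⟩ := hG.exists_walk_length_eq_dist u v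
  cases p with
  | nil => exact absurd rfl huv
  | cons h q =>
    refine ⟨_, h, ?_⟩
    have := dist_le q
    rw [Walk.length_cons] at hp
    omega

variable [Fintype V]

theorem mem_subtreeFinset {s : Finset V} : s ∈ subtreeFinset G ↔ G.IsSubtree s := by
  simp [subtreeFinset]

theorem mem_cutSubtrees {u w : V} {s : Finset V} :
    s ∈ cutSubtrees G u w ↔ G.IsSubtree s ∧ u ∈ s ∧ w ∉ s := by
  simp [cutSubtrees, mem_subtreeFinset]

theorem mem_subtreesThrough {v : V} {s : Finset V} :
    s ∈ subtreesThrough G v ↔ G.IsSubtree s ∧ v ∈ s := by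
  simp [subtreesThrough, mem_subtreeFinset]

/-- Removing some vertices of degree at most one from a connected graph leaves a subtree. -/
theorem isSubtree_of_degree_le_one (hG : G.Connected) {s : Finset V} (hs : s.Nonempty)
    (h : ∀ v, v ∉ s → G.degree v ≤ 1) : G.IsSubtree s := by
  refine ⟨hs, (SimpleGraph.connected_iff _).2 ⟨?_, ⟨⟨hs.choose, hs.choose_spec⟩⟩⟩⟩
  refine hG.preconnected.induce_of_degree_eq_one fun v hv x hx y hy => ?_
  have := h v (fun hv' => hv hv')
  rw [← card_neighborFinset_eq_degree, Finset.card_le_one] at this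
  exact this x (by simpa using hx) y (by simpa using hy)

/-- The subtrees avoiding `w` hanging at the neighbours of `w` other than `p` are at most half as
many as the subtrees containing `w` and avoiding `p`, unless there is exactly one such neighbour. -/
theorem two_mul_sum_card_cutSubtrees_le (hG : G.IsAcyclic) {w p : V} (hwp : G.Adj w p)
    (hK : ((G.neighborFinset w).erase p).card ≠ 1) :
    2 * ∑ u ∈ (G.neighborFinset w).erase p, (cutSubtrees G u w).card
      ≤ (cutSubtrees G w p).card := by
  set K := (G.neighborFinset w).erase p with hKdef
  have memK : ∀ {u}, u ∈ K ↔ u ≠ p ∧ G.Adj w u := by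
    intro u; simp [hKdef]
  rcases K.eq_empty_or_nonempty with hK0 | hKne
  · simp [hK0]
  have h1 : 1 < K.card := by
    have := hKne.card_pos
    omega
  obtain ⟨c, hc, d, hd, hcd⟩ := Finset.one_lt_card.1 h1
  rw [← Finset.card_sigma]
  set D := K.sigma (fun u => cutSubtrees G u w) with hD
  have memD : ∀ {x : Σ _ : V, Finset V}, x ∈ D ↔
      (x.1 ≠ p ∧ G.Adj w x.1) ∧ G.IsSubtree x.2 ∧ x.1 ∈ x.2 ∧ w ∉ x.2 := by
    intro x; rw [hD, Finset.mem_sigma, memK, mem_cutSubtrees]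
  have uniq : ∀ x ∈ D, ∀ u, G.Adj w u → u ∈ x.2 → u = x.1 := by
    intro x hx u hu hux
    obtain ⟨⟨_, h2⟩, h3, h4, h5⟩ := memD.1 hx
    exact h3.eq_of_adj_of_adj hG h5 hux h4 hu h2
  let g : (Σ _ : V, Finset V) → Finset V := fun x => insert w x.2
  let k : (Σ _ : V, Finset V) → Finset V := fun x =>
    if x.1 = c then (if x.2 = {c} then {w} else insert d (insert w x.2))
    else insert c (insert w x.2)
  have hwc := (memK.1 hc).2
  have hwd := (memK.1 hd).2
  have recover : ∀ x ∈ D, ∀ y ∈ D, x.2 = y.2 → x = y := by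
    rintro ⟨a, s⟩ hx ⟨b, t⟩ hy hst
    dsimp only at hst
    subst hst
    have := uniq _ hy a (memD.1 hx).1.2 (memD.1 hx).2.2.1
    dsimp only at this
    rw [this]
  have gsub : ∀ x ∈ D, g x ∈ cutSubtrees G w p := by
    intro x hx
    obtain ⟨⟨h1, h2⟩, h3, h4, h5⟩ := memD.1 hx
    refine mem_cutSubtrees.2 ⟨h3.insert_of_adj h4 h2.symm, Finset.mem_insert_self _ _, ?_⟩
    rw [Finset.mem_insert, not_or]
    exact ⟨hwp.ne', fun hp => h1 (uniq x hx p hwp hp).symm⟩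
  have ksub : ∀ x ∈ D, k x ∈ cutSubtrees G w p := by
    intro x hx
    obtain ⟨hg1, hg2, hg3⟩ := mem_cutSubtrees.1 (gsub x hx)
    simp only [k]
    split_ifs
    · exact mem_cutSubtrees.2 ⟨isSubtree_singleton w, by simp, by simpa using hwp.ne'⟩
    · refine mem_cutSubtrees.2 ⟨hg1.insert_of_adj hg2 hwd, Finset.mem_insert_of_mem hg2, ?_⟩
      rw [Finset.mem_insert, not_or]
      exact ⟨(memK.1 hd).1.symm, hg3⟩
    · refine mem_cutSubtrees.2 ⟨hg1.insert_of_adj hg2 hwc, Finset.mem_insert_of_mem hg2, ?_⟩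
      rw [Finset.mem_insert, not_or]
      exact ⟨(memK.1 hc).1.symm, hg3⟩
  have ginj : Set.InjOn g D := by
    intro x hx y hy hxy
    refine recover x hx y hy ?_
    have hx5 := (memD.1 hx).2.2.2
    have hy5 := (memD.1 hy).2.2.2
    rw [← Finset.erase_insert hx5, ← Finset.erase_insert hy5]
    exact congrArg (Finset.erase · w) hxy
  have mixed : ∀ x ∈ D, ∀ y ∈ D, x.1 = c → y.1 ≠ c →
      insert d (insert w x.2) = insert c (insert w y.2) → x.2 = {c} := by
    intro x hx y hy hxc hyc hxy
    obtain ⟨⟨_, hx2⟩, hx3, hx4, hx5⟩ := memD.1 hx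
    obtain ⟨⟨_, hy2⟩, hy3, hy4, hy5⟩ := memD.1 hy
    have hyd : y.1 = d := by
      have : y.1 ∈ insert d (insert w x.2) := by rw [hxy]; simp [hy4]
      rcases Finset.mem_insert.1 this with h | h
      · exact h
      rcases Finset.mem_insert.1 h with h | h
      · exact absurd h hy2.ne'
      · exact absurd ((uniq x hx _ hy2 h).trans hxc) hyc
    refine Finset.eq_singleton_iff_unique_mem.2 ⟨hxc ▸ hx4, fun z hz => ?_⟩
    by_contra hzc
    have hzw : z ≠ w := fun h => hx5 (h ▸ hz)
    have hzy : z ∈ y.2 := by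
      have : z ∈ insert c (insert w y.2) := by rw [← hxy]; simp [hz]
      simpa [hzc, hzw] using this
    have hcy : c ∉ y.2 := fun h => hyc (uniq y hy c hwc h).symm
    have ht : G.IsSubtree (insert w y.2) := hy3.insert_of_adj hy4 hy2.symm
    have hdis := hx3.disjoint_of_adj hG ht hwc.symm (hxc ▸ hx4) hx5
      (Finset.mem_insert_self _ _) (by simp [hwc.ne', hcy])
    exact Finset.disjoint_left.1 hdis hz (by simp [hzy])
  have kcase : ∀ x ∈ D, (x.1 = c ∧ x.2 = {c} ∧ k x = {w}) ∨
      (x.1 = c ∧ x.2 ≠ {c} ∧ k x = insert d (insert w x.2) ∧ d ∉ insert w x.2) ∨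
      (x.1 ≠ c ∧ k x = insert c (insert w x.2) ∧ c ∉ insert w x.2) := by
    intro x hx
    by_cases h1 : x.1 = c
    · by_cases h2 : x.2 = {c}
      · exact Or.inl ⟨h1, h2, by simp [k, h1, h2]⟩
      · refine Or.inr (Or.inl ⟨h1, h2, by simp [k, h1, h2], ?_⟩)
        rw [Finset.mem_insert, not_or]
        exact ⟨hwd.ne', fun h => hcd ((uniq x hx d hwd h).trans h1).symm⟩
    · refine Or.inr (Or.inr ⟨h1, by simp [k, h1], ?_⟩)
      rw [Finset.mem_insert, not_or]
      exact ⟨hwc.ne', fun h => h1 (uniq x hx c hwc h).symm⟩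
  have nontriv : ∀ e, G.Adj w e → ∀ s : Finset V, ({w} : Finset V) ≠ insert e s := by
    intro e he s h
    have : e ∈ ({w} : Finset V) := by rw [h]; simp
    exact he.ne' (by simpa using this)
  have kinj : Set.InjOn k D := by
    intro x hx y hy hxy
    rcases kcase x hx with ⟨hx1, hx2, hx3⟩ | ⟨hx1, hx2, hx3, hx4⟩ | ⟨hx1, hx3, hx4⟩ <;>
    rcases kcase y hy with ⟨hy1, hy2, hy3⟩ | ⟨hy1, hy2, hy3, hy4⟩ | ⟨hy1, hy3, hy4⟩ <;>
    rw [hx3, hy3] at hxy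
    · exact recover x hx y hy (hx2.trans hy2.symm)
    · exact absurd hxy (nontriv d hwd _)
    · exact absurd hxy (nontriv c hwc _)
    · exact absurd hxy.symm (nontriv d hwd _)
    · refine ginj hx hy ?_
      have := congrArg (Finset.erase · d) hxy
      simpa only [Finset.erase_insert hx4, Finset.erase_insert hy4] using this
    · exact absurd (mixed x hx y hy hx1 hy1 hxy) hx2
    · exact absurd hxy.symm (nontriv c hwc _)
    · exact absurd (mixed y hy x hx hy1 hx1 hxy.symm) hy2
    · refine ginj hx hy ?_
      have := congrArg (Finset.erase · c) hxy
      simpa only [Finset.erase_insert hx4, Finset.erase_insert hy4] using this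
  have hdisj : Disjoint (D.image g) (D.image k) := by
    rw [Finset.disjoint_left]
    intro s hs1 hs2
    obtain ⟨x, hx, rfl⟩ := Finset.mem_image.1 hs1
    obtain ⟨y, hy, hxy⟩ := Finset.mem_image.1 hs2
    obtain ⟨⟨_, hx2⟩, hx3, hx4, hx5⟩ := memD.1 hx
    obtain ⟨⟨_, hy2⟩, hy3, hy4, hy5⟩ := memD.1 hy
    have only : ∀ e, G.Adj w e → e ∈ k y → e = x.1 := by
      intro e he hey
      rw [hxy] at hey
      rcases Finset.mem_insert.1 hey with h | h
      · exact absurd h he.ne'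
      · exact uniq x hx e he h
    rcases kcase y hy with ⟨_, _, h3⟩ | ⟨h1, _, h3, _⟩ | ⟨h1, h3, _⟩
    · have : x.1 ∈ k y := by rw [hxy]; exact Finset.mem_insert_of_mem hx4
      rw [h3] at this
      exact hx2.ne' (by simpa using this)
    · have hdx := only d hwd (by rw [h3]; simp)
      have hyx := only y.1 hy2 (by rw [h3]; simp [hy4])
      exact hcd ((h1.symm.trans hyx).trans hdx.symm)
    · have hcx := only c hwc (by rw [h3]; simp)
      have hyx := only y.1 hy2 (by rw [h3]; simp [hy4])
      exact h1 (hyx.trans hcx.symm)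
  calc 2 * D.card = (D.image g).card + (D.image k).card := by
        rw [Finset.card_image_of_injOn ginj, Finset.card_image_of_injOn kinj, two_mul]
    _ = (D.image g ∪ D.image k).card := (Finset.card_union_of_disjoint hdisj).symm
    _ ≤ _ := by
        refine Finset.card_le_card (Finset.union_subset ?_ ?_)
        · exact Finset.image_subset_iff.2 gsub
        · exact Finset.image_subset_iff.2 ksub

/-- In a tree without vertices of degree two, the number of subtrees avoiding `v` is at most twice
the number of those that also contain a neighbour of `v`. -/
theorem card_filter_notMem_le (hG : G.IsTree) (h3 : ∀ v, G.degree v ≠ 2) (v : V) :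
    ((subtreeFinset G).filter (fun s => v ∉ s)).card
      ≤ 2 * ∑ r ∈ G.neighborFinset v, (cutSubtrees G r v).card := by
  have hpar : ∀ u, ∃ w, u ≠ v → G.Adj u w ∧ G.dist w v < G.dist u v := by
    intro u
    by_cases huv : u = v
    · exact ⟨v, fun h => absurd huv h⟩
    · obtain ⟨w, hw⟩ := exists_adj_dist_lt hG.connected huv
      exact ⟨w, fun _ => hw⟩
  choose par hpar using hpar
  set S : Finset V := Finset.univ.erase v with hS
  have memS : ∀ {u}, u ∈ S ↔ u ≠ v := by intro u; simp [hS]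
  set F := ∑ u ∈ S, (cutSubtrees G u (par u)).card with hF
  have cover : ((subtreeFinset G).filter (fun s => v ∉ s)).card ≤ F := by
    refine (Finset.card_le_card ?_).trans Finset.card_biUnion_le
    intro s hs
    rw [Finset.mem_filter, mem_subtreeFinset] at hs
    obtain ⟨u, hus, hmin⟩ := Finset.exists_min_image s (fun x => G.dist x v) hs.1.1
    have huv : u ≠ v := fun h => hs.2 (h ▸ hus)
    refine Finset.mem_biUnion.2 ⟨u, memS.2 huv, mem_cutSubtrees.2 ⟨hs.1, hus, fun hp => ?_⟩⟩
    exact absurd (hmin _ hp) (not_le.2 (hpar u huv).2)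
  have fiber : ∀ w ∈ S, 2 * ∑ u ∈ S with par u = w, (cutSubtrees G u (par u)).card
      ≤ (cutSubtrees G w (par w)).card := by
    intro w hw
    have hwv := memS.1 hw
    have hwp := (hpar w hwv).1
    refine le_trans ?_ (two_mul_sum_card_cutSubtrees_le hG.isAcyclic hwp ?_)
    · refine Nat.mul_le_mul_left 2 ?_
      calc ∑ u ∈ S with par u = w, (cutSubtrees G u (par u)).card
          = ∑ u ∈ S with par u = w, (cutSubtrees G u w).card := by
            refine Finset.sum_congr rfl fun u hu => ?_
            rw [(Finset.mem_filter.1 hu).2]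
        _ ≤ _ := by
            refine Finset.sum_le_sum_of_subset fun u hu => ?_
            obtain ⟨huS, rfl⟩ := Finset.mem_filter.1 hu
            have hu1 := hpar u (memS.1 huS)
            rw [Finset.mem_erase, mem_neighborFinset]
            refine ⟨fun he => ?_, hu1.1.symm⟩
            have h2 := (hpar _ hwv).2
            rw [← he] at h2
            exact absurd hu1.2 (not_lt.2 h2.le)
    · rw [Finset.card_erase_of_mem (by simpa using hwp), card_neighborFinset_eq_degree]
      have := h3 w
      omega
  have root : ∑ u ∈ S with par u = v, (cutSubtrees G u (par u)).card
      ≤ ∑ r ∈ G.neighborFinset v, (cutSubtrees G r v).card := by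
    calc ∑ u ∈ S with par u = v, (cutSubtrees G u (par u)).card
        = ∑ u ∈ S with par u = v, (cutSubtrees G u v).card := by
          refine Finset.sum_congr rfl fun u hu => ?_
          rw [(Finset.mem_filter.1 hu).2]
      _ ≤ _ := by
          refine Finset.sum_le_sum_of_subset fun u hu => ?_
          obtain ⟨huS, hpu⟩ := Finset.mem_filter.1 hu
          rw [mem_neighborFinset, ← hpu]
          exact (hpar u (memS.1 huS)).1.symm
  have split : F = ∑ u ∈ S with par u = v, (cutSubtrees G u (par u)).card
      + ∑ w ∈ S, ∑ u ∈ S with par u = w, (cutSubtrees G u (par u)).card := by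
    rw [hF, ← Finset.sum_fiberwise S par]
    exact (Finset.add_sum_erase _ _ (Finset.mem_univ v)).symm
  have half : 2 * ∑ w ∈ S, ∑ u ∈ S with par u = w, (cutSubtrees G u (par u)).card ≤ F := by
    rw [Finset.mul_sum]
    exact Finset.sum_le_sum fiber
  omega

theorem card_cutSubtrees_mul_le (hG : G.IsAcyclic) {u w : V} (huw : G.Adj u w) :
    (cutSubtrees G u w).card * (cutSubtrees G w u).card ≤ (subtreesThrough G u).card := by
  rw [← Finset.card_product]
  refine Finset.card_le_card_of_injOn (fun x => x.1 ∪ x.2) ?_ ?_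
  · rintro ⟨s, t⟩ hst
    obtain ⟨hs, ht⟩ := Finset.mem_product.1 hst
    obtain ⟨hs1, hs2, -⟩ := mem_cutSubtrees.1 hs
    obtain ⟨ht1, ht2, -⟩ := mem_cutSubtrees.1 ht
    exact mem_subtreesThrough.2 ⟨hs1.union_of_adj ht1 hs2 ht2 huw, Finset.mem_union_left _ hs2⟩
  · rintro ⟨s, t⟩ hst ⟨s', t'⟩ hst' heq
    obtain ⟨hs, ht⟩ := Finset.mem_product.1 hst
    obtain ⟨hs', ht'⟩ := Finset.mem_product.1 hst'
    obtain ⟨hs1, hs2, hs3⟩ := mem_cutSubtrees.1 hs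
    obtain ⟨ht1, ht2, ht3⟩ := mem_cutSubtrees.1 ht
    obtain ⟨hs1', hs2', hs3'⟩ := mem_cutSubtrees.1 hs'
    obtain ⟨ht1', ht2', ht3'⟩ := mem_cutSubtrees.1 ht'
    dsimp only at *
    have d1 := Finset.disjoint_left.1 (hs1.disjoint_of_adj hG ht1' huw hs2 hs3 ht2' ht3')
    have d2 := Finset.disjoint_left.1 (hs1'.disjoint_of_adj hG ht1 huw hs2' hs3' ht2 ht3)
    have key : ∀ x, (x ∈ s ∨ x ∈ t) ↔ (x ∈ s' ∨ x ∈ t') := by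
      intro x
      rw [← Finset.mem_union, ← Finset.mem_union, heq]
    have e1 : s = s' := by
      ext x
      have := key x
      have := @d1 x
      have := @d2 x
      tauto
    have e2 : t = t' := by
      ext x
      have := key x
      have := @d1 x
      have := @d2 x
      tauto
    rw [e1, e2]

theorem card_subtreesThrough_eq (u w : V) :
    (subtreesThrough G u).card = (cutSubtrees G u w).card
      + ((subtreeFinset G).filter (fun s => u ∈ s ∧ w ∈ s)).card := by
  rw [← Finset.card_filter_add_card_filter_not (s := subtreesThrough G u) (fun s => w ∉ s)]
  simp only [subtreesThrough, cutSubtrees, Finset.filter_filter, not_not]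

theorem card_cutSubtrees_le_of_le {u w : V}
    (h : (subtreesThrough G w).card ≤ (subtreesThrough G u).card) :
    (cutSubtrees G w u).card ≤ (cutSubtrees G u w).card := by
  rw [card_subtreesThrough_eq u w, card_subtreesThrough_eq w u] at h
  have : ∀ s : Finset V, (w ∈ s ∧ u ∈ s) ↔ (u ∈ s ∧ w ∈ s) := fun s => and_comm
  simp only [this] at h
  omega

theorem card_cutSubtrees_le_one (hG : G.IsTree) {r v : V} (hrv : G.Adj r v)
    (hr : G.degree r ≤ 1) : (cutSubtrees G r v).card ≤ 1 := by
  have ht : G.IsSubtree (Finset.univ.erase r) := by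
    refine isSubtree_of_degree_le_one hG.connected ⟨v, by simp [hrv.ne']⟩ fun x hx => ?_
    have : x = r := by simpa using hx
    rwa [this]
  have single : ∀ s ∈ cutSubtrees G r v, s = {r} := by
    intro s hs
    obtain ⟨h1, h2, h3⟩ := mem_cutSubtrees.1 hs
    have hd := h1.disjoint_of_adj hG.isAcyclic ht hrv h2 h3 (by simp [hrv.ne']) (by simp)
    refine Finset.eq_singleton_iff_unique_mem.2 ⟨h2, fun x hx => ?_⟩
    simpa using Finset.disjoint_left.1 hd hx
  exact Finset.card_le_one.2 fun s hs t ht => (single s hs).trans (single t ht).symm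

theorem two_pow_card_leaves_le (hG : G.Connected) {v : V} (hv : 2 ≤ G.degree v) :
    2 ^ (Finset.univ.filter (fun x => G.degree x ≤ 1)).card ≤ (subtreesThrough G v).card := by
  rw [← Finset.card_powerset]
  refine Finset.card_le_card_of_injOn (fun X => Xᶜ) ?_ (compl_injective.injOn)
  intro X hX
  have hX' := Finset.mem_powerset.1 hX
  have hvX : v ∈ Xᶜ := by
    rw [Finset.mem_compl]
    intro h
    have := (Finset.mem_filter.1 (hX' h)).2
    omega
  refine mem_subtreesThrough.2 ⟨isSubtree_of_degree_le_one hG ⟨v, hvX⟩ fun x hx => ?_, hvX⟩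
  rw [Finset.mem_compl, not_not] at hx
  exact (Finset.mem_filter.1 (hX' hx)).2

/-- A lower bound for the number of leaves of a tree whose other degrees are all at least three. -/
theorem card_add_degree_le_two_mul_card_leaves (hG : G.IsTree)
    (h3 : ∀ v, 2 ≤ G.degree v → 3 ≤ G.degree v) {v : V} (hv : 2 ≤ G.degree v) :
    Fintype.card V + G.degree v
      ≤ 2 * (Finset.univ.filter (fun x => G.degree x ≤ 1)).card + 1 := by
  have hsum := G.sum_degrees_eq_twice_card_edges
  have hcard := hG.card_edgeFinset
  have hnt : Nontrivial V := by
    have : 0 < G.degree v := by omega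
    obtain ⟨w, hw⟩ := (G.degree_pos_iff_exists_adj v).1 this
    exact ⟨v, w, hw.ne⟩
  have hpos : ∀ x, 1 ≤ G.degree x := fun x => hG.connected.preconnected.degree_pos_of_nontrivial x
  have hle : ∑ x ∈ Finset.univ.erase v, (3 : ℕ) ≤ ∑ x ∈ Finset.univ.erase v,
      (G.degree x + if G.degree x ≤ 1 then 2 else 0) := by
    refine Finset.sum_le_sum fun x _ => ?_
    have := hpos x
    have := h3 x
    split_ifs <;> omega
  have hL : ∑ x, (if G.degree x ≤ 1 then 2 else 0)
      = 2 * (Finset.univ.filter (fun x => G.degree x ≤ 1)).card := by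
    rw [← Finset.sum_filter, Finset.sum_const, smul_eq_mul, mul_comm]
  rw [← Finset.add_sum_erase _ _ (Finset.mem_univ v)] at hsum hL
  rw [if_neg (by omega)] at hL
  rw [Finset.sum_add_distrib, Finset.sum_const, Finset.card_erase_of_mem (Finset.mem_univ v),
    Finset.card_univ, smul_eq_mul] at hle
  omega

end Subtrees

theorem hundred_mul_pow_four_le_two_pow {n : ℕ} (hn : 30 ≤ n) : 100 * n ^ 4 ≤ 2 ^ n := by
  induction n, hn using Nat.le_induction with
  | base => norm_num
  | succ n hn ih =>
    have h1 : (n + 1) ^ 4 ≤ 2 * n ^ 4 := by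
      obtain ⟨m, rfl⟩ := Nat.exists_eq_add_of_le hn
      ring_nf
      nlinarith [Nat.zero_le m, Nat.zero_le (m ^ 2), Nat.zero_le (m ^ 3), Nat.zero_le (m ^ 4)]
    calc 100 * (n + 1) ^ 4 ≤ 2 * (100 * n ^ 4) := by linarith
      _ ≤ 2 ^ (n + 1) := by rw [pow_succ 2]; omega

theorem pow_four_le_mul_two_pow (d : ℕ) : d ^ 4 ≤ 21 * 2 ^ d := by
  rcases Nat.lt_or_ge d 6 with h | h
  · interval_cases d <;> norm_num
  induction d, h using Nat.le_induction with
  | base => norm_num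
  | succ n hn ih =>
    have h1 : (n + 1) ^ 4 ≤ 2 * n ^ 4 := by
      obtain ⟨m, rfl⟩ := Nat.exists_eq_add_of_le hn
      ring_nf
      nlinarith [Nat.zero_le m, Nat.zero_le (m ^ 2), Nat.zero_le (m ^ 3), Nat.zero_le (m ^ 4)]
    rw [pow_succ 2]
    omega

theorem sq_mul_sq_lt_two_pow {n d l : ℕ} (hn : 30 ≤ n) (h : n + d ≤ 2 * l + 1) :
    n ^ 2 * d ^ 2 < 2 ^ l := by
  refine lt_of_pow_lt_pow_left₀ 2 (Nat.zero_le _) ?_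
  have h1 := Nat.mul_le_mul (hundred_mul_pow_four_le_two_pow hn) (pow_four_le_mul_two_pow d)
  have h2 : 2 ^ (n + d) ≤ 2 ^ (2 * l + 1) := Nat.pow_le_pow_right (by norm_num) h
  have h3 : 0 < 2 ^ (n + d) := by positivity
  rw [pow_add] at h2 h3
  rw [pow_succ, mul_comm 2 l, pow_mul] at h2
  have h4 : (n ^ 2 * d ^ 2) ^ 2 = n ^ 4 * d ^ 4 := by ring
  rw [h4]
  have h5 : 100 * n ^ 4 * d ^ 4 = 100 * (n ^ 4 * d ^ 4) := by ring
  have h6 : 2 ^ n * (21 * 2 ^ d) = 21 * (2 ^ n * 2 ^ d) := by ring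
  omega

/-- Averages over a finset of sizes at most `n` and over a part of it are close when few elements
lie outside that part. -/
theorem abs_average_sub_average_filter_lt {α : Type*} (A : Finset α) (p : α → Prop) [DecidablePred p]
    (f : α → ℕ) {n : ℕ} (hf : ∀ a ∈ A, f a ≤ n)
    (hR : n * (A.filter (fun a => ¬ p a)).card < 2 * (A.filter p).card) :
    |(∑ a ∈ A, (f a : ℚ)) / (A.card : ℚ)
      - (∑ a ∈ A.filter p, (f a : ℚ)) / ((A.filter p).card : ℚ)| < 2 := by
  have bound : ∀ B ⊆ A, (∑ a ∈ B, (f a : ℚ)) ≤ n * B.card := by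
    intro B hB
    rw [mul_comm, ← nsmul_eq_mul]
    exact Finset.sum_le_card_nsmul _ _ _ fun a ha => by exact_mod_cast hf a (hB ha)
  have hs := bound _ (Finset.filter_subset p A)
  have ht := bound _ (Finset.filter_subset (fun a => ¬ p a) A)
  have hs0 : 0 ≤ ∑ a ∈ A.filter p, (f a : ℚ) := Finset.sum_nonneg fun _ _ => by positivity
  have ht0 : 0 ≤ ∑ a ∈ A.filter (fun a => ¬ p a), (f a : ℚ) :=
    Finset.sum_nonneg fun _ _ => by positivity
  rw [← Finset.sum_filter_add_sum_filter_not A p, ← Finset.card_filter_add_card_filter_not p]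
  have hR' : (n : ℚ) * (A.filter (fun a => ¬ p a)).card < 2 * (A.filter p).card := by
    exact_mod_cast hR
  have hN : (0 : ℚ) < (A.filter p).card := by
    have : 0 < (A.filter p).card := by
      rcases Nat.eq_zero_or_pos (A.filter p).card with h | h
      · rw [h] at hR; omega
      · exact h
    exact_mod_cast this
  push_cast
  have hr0 : (0 : ℚ) ≤ (A.filter (fun a => ¬ p a)).card := by positivity
  generalize ∑ a ∈ A.filter p, (f a : ℚ) = s at *
  generalize ∑ a ∈ A.filter (fun a => ¬ p a), (f a : ℚ) = t at *
  generalize ((A.filter p).card : ℚ) = N at *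
  generalize ((A.filter (fun a => ¬ p a)).card : ℚ) = r at *
  have hNr : 0 < N + r := by linarith
  rw [div_sub_div _ _ hNr.ne' hN.ne', abs_div, abs_of_pos (mul_pos hNr hN),
    div_lt_iff₀ (mul_pos hNr hN), abs_lt]
  have h1 := mul_le_mul_of_nonneg_right hs hr0
  have h2 := mul_le_mul_of_nonneg_right ht hN.le
  have h3 := mul_lt_mul_of_pos_right hR' hN
  have h4 := mul_nonneg hs0 hr0
  have h5 := mul_nonneg ht0 hN.le
  have h6 := mul_nonneg hr0 hN.le
  constructor <;> nlinarith

/-- If `T ∈ 𝒯₃` has `n ≥ 30` vertices then there is an internal vertex `v` with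
`|μ(T) - λ(T,v)| < 2`. -/
theorem exists_internal_vertex_approx {V : Type*} [Fintype V] (G : SimpleGraph V)
    (h : InT3 G) (hn : 30 ≤ Fintype.card V) :
    ∃ v, 2 ≤ G.degree v ∧ |mu G - lambdaV G v| < 2 := by
  obtain ⟨hT, ⟨v₀, hv₀⟩, h3⟩ := h
  obtain ⟨v, hv, hmax⟩ := Finset.exists_max_image
    (Finset.univ.filter (fun v => 2 ≤ G.degree v)) (fun v => (subtreesThrough G v).card)
    ⟨v₀, by simpa using hv₀⟩
  replace hv : 2 ≤ G.degree v := by simpa using hv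
  refine ⟨v, hv, abs_average_sub_average_filter_lt (subtreeFinset G) (fun s => v ∈ s) Finset.card
    (fun s _ => s.card_le_univ) ?_⟩
  change _ < 2 * (subtreesThrough G v).card
  set N := (subtreesThrough G v).card with hN
  have hbranch : ∀ r ∈ G.neighborFinset v, (cutSubtrees G r v).card ≤ Nat.sqrt N := by
    intro r hr
    have hvr : G.Adj v r := by simpa using hr
    rw [Nat.le_sqrt]
    rcases Nat.lt_or_ge (G.degree r) 2 with hr1 | hr2
    · have h1 := card_cutSubtrees_le_one hT hvr.symm (by omega)
      have h2 : 0 < N := Finset.card_pos.2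
        ⟨{v}, mem_subtreesThrough.2 ⟨isSubtree_singleton v, by simp⟩⟩
      exact (Nat.mul_le_mul h1 h1).trans h2
    · have h1 := card_cutSubtrees_le_of_le (hmax r (by simpa using hr2))
      exact (Nat.mul_le_mul_right _ h1).trans (card_cutSubtrees_mul_le hT.isAcyclic hvr)
  have hR := card_filter_notMem_le hT (fun x hx => by have := h3 x; omega) v
  have hsum := Finset.sum_le_card_nsmul _ _ _ hbranch
  rw [card_neighborFinset_eq_degree, smul_eq_mul] at hsum
  have hlt : Fintype.card V * G.degree v * Nat.sqrt N < N := by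
    have h1 := (sq_mul_sq_lt_two_pow hn (card_add_degree_le_two_mul_card_leaves hT h3 hv)).trans_le
      (two_pow_card_leaves_le hT.connected hv)
    rw [← hN, ← mul_pow] at h1
    have h2 := Nat.sqrt_le' N
    refine lt_of_pow_lt_pow_left₀ 2 (Nat.zero_le _) ?_
    rw [mul_pow, sq N]
    exact (Nat.mul_le_mul_left _ h2).trans_lt (Nat.mul_lt_mul_of_pos_right h1 (by omega))
  calc _ ≤ Fintype.card V * (2 * (G.degree v * Nat.sqrt N)) :=
        Nat.mul_le_mul_left _ (hR.trans (Nat.mul_le_mul_left 2 hsum))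
    _ = 2 * (Fintype.card V * G.degree v * Nat.sqrt N) := by ring
    _ < 2 * N := by omega
end

section
/- If T is a rooted tree in 𝒯₃* with root v, with n vertices of which k are not leaves, then λ(T,v) ≥ (n+1)/2 + (k−1)/10. -/
open SimpleGraph Finset BigOperators Filter

attribute [local instance] Classical.propDecidable

/-- The rooted tree `(G, v)` is in the class 𝒯₃*: `G` is a tree and either it is a
single vertex, or the root `v` has degree at least 2 and every other internal
vertex has degree at least 3. -/
noncomputable def InT3Star {V : Type*} [Fintype V] (G : SimpleGraph V) (v : V) : Prop :=
  G.IsTree ∧ (Fintype.card V = 1 ∨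
    (2 ≤ G.degree v ∧ ∀ w, w ≠ v → 2 ≤ G.degree w → 3 ≤ G.degree w))

namespace SimpleGraph

variable {V : Type*}

/-- The step relation of `G` restricted to the vertex set `s`. -/
def StepIn (G : SimpleGraph V) (s : Set V) (x y : V) : Prop :=
  G.Adj x y ∧ x ∈ s ∧ y ∈ s

/-- `s` contains `r` and every vertex of `s` can be reached from `r` inside `s`. -/
def IsRootedSubtree (G : SimpleGraph V) (r : V) (s : Finset V) : Prop :=
  r ∈ s ∧ ∀ w ∈ s, Relation.ReflTransGen (G.StepIn s) r w

lemma StepIn.symm {G : SimpleGraph V} {s : Set V} {x y : V} (h : G.StepIn s x y) :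
    G.StepIn s y x :=
  ⟨h.1.symm, h.2.2, h.2.1⟩

lemma reachable_of_reflTransGen_stepIn {G : SimpleGraph V} {s : Set V} {x y : V}
    (h : Relation.ReflTransGen (G.StepIn s) x y) : G.Reachable x y := by
  rw [reachable_iff_reflTransGen]
  exact Relation.ReflTransGen.mono (fun _ _ hab => hab.1) _ _ h

lemma reflTransGen_stepIn_of_reachable {G : SimpleGraph V} {x y : V}
    (h : G.Reachable x y) : Relation.ReflTransGen (G.StepIn Set.univ) x y := by
  rw [reachable_iff_reflTransGen] at h
  exact Relation.ReflTransGen.mono (fun _ _ hab => ⟨hab, trivial, trivial⟩) _ _ h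

lemma isSubtree_and_mem_iff (G : SimpleGraph V) (r : V) (s : Finset V) :
    G.IsSubtree s ∧ r ∈ s ↔ G.IsRootedSubtree r s := by
  constructor
  · rintro ⟨⟨-, hc⟩, hr⟩
    refine ⟨hr, fun w hw => ?_⟩
    have h := hc.preconnected ⟨r, hr⟩ ⟨w, hw⟩
    rw [reachable_iff_reflTransGen] at h
    exact h.lift (fun x : (s : Set V) => (x : V)) fun a b hab => ⟨hab, a.2, b.2⟩
  · rintro ⟨hr, h⟩
    refine ⟨⟨⟨r, hr⟩, ?_⟩, hr⟩
    have key : ∀ w, Relation.ReflTransGen (G.StepIn s) r w → ∀ hw : w ∈ (s : Set V),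
        (G.induce (s : Set V)).Reachable ⟨r, hr⟩ ⟨w, hw⟩ := by
      intro w hrw
      induction hrw with
      | refl => intro _; exact Reachable.refl _
      | tail _ hbc ih =>
        intro hw
        have hadj : (G.induce (s : Set V)).Adj ⟨_, hbc.2.1⟩ ⟨_, hw⟩ := hbc.1
        exact (ih hbc.2.1).trans hadj.reachable
    exact { preconnected := fun a b =>
              (key a (h a a.2) a.2).symm.trans (key b (h b b.2) b.2)
            nonempty := ⟨⟨r, hr⟩⟩ }

/-- Reachability inside `s` is reachability inside the part of `s` in the component of `r`. -/
lemma reflTransGen_stepIn_mono_component {G : SimpleGraph V} {s t : Set V} {r w : V}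
    (hr : r ∈ t) (ht : ∀ x ∈ s, G.Reachable r x → x ∈ t)
    (h : Relation.ReflTransGen (G.StepIn s) r w) : Relation.ReflTransGen (G.StepIn t) r w := by
  have : Relation.ReflTransGen (G.StepIn t) r w ∧ w ∈ t := by
    induction h with
    | refl => exact ⟨.refl, hr⟩
    | tail hrb hbc ih =>
      have hc := ht _ hbc.2.2
        ((reachable_of_reflTransGen_stepIn hrb).trans hbc.1.reachable)
      exact ⟨ih.1.tail ⟨hbc.1, ih.2, hc⟩, hc⟩
  exact this.1

lemma IsRootedSubtree.reachable {G : SimpleGraph V} {r w : V} {s : Finset V}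
    (h : G.IsRootedSubtree r s) (hw : w ∈ s) : G.Reachable r w :=
  reachable_of_reflTransGen_stepIn (h.2 w hw)

lemma deleteEdge_adj {G : SimpleGraph V} {r c x y : V} :
    (G.deleteEdges {s(r, c)}).Adj x y ↔ G.Adj x y ∧ s(x, y) ≠ s(r, c) := by
  simp [deleteEdges_adj]

/-- A walk from `r` inside `s` either avoids the edge `rc` or can be started at `c`. -/
lemma reflTransGen_stepIn_deleteEdge {G : SimpleGraph V} {s : Set V} {r c w : V}
    (h : Relation.ReflTransGen (G.StepIn s) r w) :
    Relation.ReflTransGen ((G.deleteEdges {s(r, c)}).StepIn s) r w ∨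
      c ∈ s ∧ Relation.ReflTransGen ((G.deleteEdges {s(r, c)}).StepIn s) c w := by
  induction h with
  | refl => exact .inl .refl
  | @tail x y _ hxy ih =>
    by_cases he : s(x, y) = s(r, c)
    · rw [Sym2.eq_iff] at he
      rcases he with ⟨rfl, rfl⟩ | ⟨rfl, rfl⟩
      · exact .inr ⟨hxy.2.2, .refl⟩
      · exact .inl .refl
    · have hstep : (G.deleteEdges {s(r, c)}).StepIn s x y :=
        ⟨deleteEdge_adj.2 ⟨hxy.1, he⟩, hxy.2⟩
      exact ih.imp (fun h => h.tail hstep) fun h => ⟨h.1, h.2.tail hstep⟩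

lemma reachable_deleteEdge {G : SimpleGraph V} {r c w : V} (h : G.Reachable r w) :
    (G.deleteEdges {s(r, c)}).Reachable r w ∨ (G.deleteEdges {s(r, c)}).Reachable c w :=
  (reflTransGen_stepIn_deleteEdge (reflTransGen_stepIn_of_reachable h)).imp
    reachable_of_reflTransGen_stepIn fun h => reachable_of_reflTransGen_stepIn h.2

variable [Fintype V]

/-- The subtrees of `G` containing `r`. -/
noncomputable def rootedSubtrees (G : SimpleGraph V) (r : V) : Finset (Finset V) :=
  univ.filter (G.IsRootedSubtree r)

/-- The vertices reachable from `r`. -/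
noncomputable def component (G : SimpleGraph V) (r : V) : Finset V :=
  univ.filter (G.Reachable r)

/-- The number of neighbours of `w`. -/
noncomputable def valency (G : SimpleGraph V) (w : V) : ℕ :=
  (univ.filter (G.Adj w)).card

/-- The vertices other than `r` in the component of `r` that are not leaves. -/
noncomputable def innerVertices (G : SimpleGraph V) (r : V) : Finset V :=
  univ.filter fun w => G.Reachable r w ∧ w ≠ r ∧ G.valency w ≠ 1

@[simp] lemma mem_rootedSubtrees {G : SimpleGraph V} {r : V} {s : Finset V} :
    s ∈ G.rootedSubtrees r ↔ G.IsRootedSubtree r s := by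
  simp [rootedSubtrees]

@[simp] lemma mem_component {G : SimpleGraph V} {r w : V} :
    w ∈ G.component r ↔ G.Reachable r w := by
  simp [component]

/-- Subtrees at `r` split along an edge `rc` that is a bridge. -/
lemma sum_rootedSubtrees {G : SimpleGraph V} {r c : V} (hadj : G.Adj r c)
    (hb : ¬ (G.deleteEdges {s(r, c)}).Reachable r c) (f : Finset V → ℚ) :
    ∑ s ∈ G.rootedSubtrees r, f s =
      ∑ p ∈ (G.deleteEdges {s(r, c)}).rootedSubtrees r ×ˢ
        insert ∅ ((G.deleteEdges {s(r, c)}).rootedSubtrees c), f (p.1 ∪ p.2) := by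
  set H := G.deleteEdges {s(r, c)} with hH
  have hdis : ∀ w, H.Reachable r w → ¬ H.Reachable c w := fun w h1 h2 => hb (h1.trans h2.symm)
  have hHG : H ≤ G := deleteEdges_le _
  have hcover : ∀ s, G.IsRootedSubtree r s → s ∩ H.component r ∪ s ∩ H.component c = s := by
    intro s hs
    ext w
    simp only [mem_union, mem_inter, mem_component]
    refine ⟨by tauto, fun hw => ?_⟩
    have := reachable_deleteEdge (c := c) (hs.reachable hw)
    tauto
  refine Finset.sum_nbij' (fun s => (s ∩ H.component r, s ∩ H.component c))
    (fun p => p.1 ∪ p.2) ?_ ?_ ?_ ?_ ?_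
  · intro s hs
    rw [mem_rootedSubtrees] at hs
    simp only [mem_product, mem_rootedSubtrees, mem_insert]
    refine ⟨⟨by simp [hs.1], fun w hw => ?_⟩, ?_⟩
    · rw [mem_inter, mem_component] at hw
      rcases reflTransGen_stepIn_deleteEdge (c := c) (hs.2 w hw.1) with h | h
      · exact reflTransGen_stepIn_mono_component (by simp [hs.1])
          (fun x hx hrx => by simpa using ⟨hx, hrx⟩) h
      · exact absurd (reachable_of_reflTransGen_stepIn h.2) (hdis w hw.2)
    · have key : ∀ w ∈ s ∩ H.component c,
          c ∈ s ∧ Relation.ReflTransGen (H.StepIn (s ∩ H.component c : Finset V)) c w := by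
        intro w hw
        rw [mem_inter, mem_component] at hw
        rcases reflTransGen_stepIn_deleteEdge (c := c) (hs.2 w hw.1) with h | h
        · exact absurd hw.2 (hdis w (reachable_of_reflTransGen_stepIn h))
        · have hc : c ∈ s := h.1
          exact ⟨hc, reflTransGen_stepIn_mono_component (by simp [hc])
            (fun x hx hrx => by simpa using ⟨hx, hrx⟩) h.2⟩
      rcases (s ∩ H.component c).eq_empty_or_nonempty with h | ⟨w, hw⟩
      · exact .inl h
      · exact .inr ⟨by simp [(key w hw).1], fun w hw => (key w hw).2⟩
  · rintro ⟨a, b⟩ hab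
    simp only [mem_product, mem_rootedSubtrees, mem_insert] at hab ⊢
    obtain ⟨ha, hb'⟩ := hab
    have hr : r ∈ a ∪ b := mem_union_left _ ha.1
    refine ⟨hr, fun w hw => ?_⟩
    rcases mem_union.1 hw with hw | hw
    · exact Relation.ReflTransGen.mono (fun x y h =>
        ⟨hHG h.1, by simpa using Or.inl h.2.1, by simpa using Or.inl h.2.2⟩) _ _ (ha.2 w hw)
    · rcases hb' with rfl | hb'
      · simp at hw
      · have hc : c ∈ a ∪ b := mem_union_right _ hb'.1
        refine Relation.ReflTransGen.head ⟨hadj, hr, hc⟩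
          (Relation.ReflTransGen.mono (fun x y h => ?_) _ _ (hb'.2 w hw))
        exact ⟨hHG h.1, by simpa using Or.inr h.2.1, by simpa using Or.inr h.2.2⟩
  · intro s hs
    exact hcover s (mem_rootedSubtrees.1 hs)
  · rintro ⟨a, b⟩ hab
    simp only [mem_product, mem_rootedSubtrees, mem_insert] at hab
    obtain ⟨ha, hb'⟩ := hab
    have h1 : ∀ w ∈ a, H.Reachable r w := fun w => ha.reachable
    have h2 : ∀ w ∈ b, H.Reachable c w := by
      rcases hb' with rfl | hb'
      · simp
      · exact fun w => hb'.reachable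
    simp only [Prod.mk.injEq]
    constructor <;> ext w <;> simp only [mem_inter, mem_union, mem_component] <;>
      have := h1 w <;> have := h2 w <;> have := hdis w <;> tauto
  · intro s hs
    rw [hcover s (mem_rootedSubtrees.1 hs)]

lemma empty_notMem_rootedSubtrees (G : SimpleGraph V) (r : V) : ∅ ∉ G.rootedSubtrees r := by
  simp [IsRootedSubtree]

lemma card_rootedSubtrees {G : SimpleGraph V} {r c : V} (hadj : G.Adj r c)
    (hb : ¬ (G.deleteEdges {s(r, c)}).Reachable r c) :
    ((G.rootedSubtrees r).card : ℚ) =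
      ((G.deleteEdges {s(r, c)}).rootedSubtrees r).card *
        (1 + ((G.deleteEdges {s(r, c)}).rootedSubtrees c).card) := by
  have h := sum_rootedSubtrees hadj hb fun _ => 1
  simp only [sum_const, card_product, nsmul_eq_mul, mul_one,
    card_insert_of_notMem (empty_notMem_rootedSubtrees _ _)] at h
  rw [h]
  push_cast
  ring

lemma sum_card_rootedSubtrees {G : SimpleGraph V} {r c : V} (hadj : G.Adj r c)
    (hb : ¬ (G.deleteEdges {s(r, c)}).Reachable r c) :
    ∑ s ∈ G.rootedSubtrees r, (s.card : ℚ) =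
      (∑ s ∈ (G.deleteEdges {s(r, c)}).rootedSubtrees r, (s.card : ℚ)) *
          (1 + ((G.deleteEdges {s(r, c)}).rootedSubtrees c).card) +
        ((G.deleteEdges {s(r, c)}).rootedSubtrees r).card *
          ∑ s ∈ (G.deleteEdges {s(r, c)}).rootedSubtrees c, (s.card : ℚ) := by
  rw [sum_rootedSubtrees hadj hb fun s => (s.card : ℚ)]
  set H := G.deleteEdges {s(r, c)}
  have hcard : ∀ p ∈ H.rootedSubtrees r ×ˢ insert ∅ (H.rootedSubtrees c),
      ((p.1 ∪ p.2).card : ℚ) = p.1.card + p.2.card := by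
    rintro ⟨a, b⟩ hab
    simp only [mem_product, mem_rootedSubtrees, mem_insert] at hab
    obtain ⟨ha, rfl | hb'⟩ := hab
    · simp
    · rw [card_union_of_disjoint, Nat.cast_add]
      rw [Finset.disjoint_left]
      exact fun w h1 h2 => hb ((ha.reachable h1).trans (hb'.reachable h2).symm)
  rw [sum_congr rfl hcard, sum_product]
  simp only [sum_add_distrib, sum_const, nsmul_eq_mul, ← mul_sum,
    sum_insert (empty_notMem_rootedSubtrees _ _), card_empty, Nat.cast_zero]
  ring

lemma valency_eq_valency_deleteEdge_add_one {G : SimpleGraph V} {r c : V} (hadj : G.Adj r c) :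
    G.valency r = (G.deleteEdges {s(r, c)}).valency r + 1 := by
  have : univ.filter (G.Adj r) =
      insert c (univ.filter ((G.deleteEdges {s(r, c)}).Adj r)) := by
    ext x
    simp only [mem_filter, mem_univ, true_and, mem_insert, deleteEdge_adj, ne_eq, Sym2.eq_iff]
    by_cases hx : x = c
    · simp [hx, hadj]
    · have := hadj.ne
      simp [hx, this]
  rw [valency, this, card_insert_of_notMem (by simp)]
  unfold valency
  convert rfl

lemma valency_deleteEdge_of_ne {G : SimpleGraph V} {r c w : V} (hr : w ≠ r) (hc : w ≠ c) :
    (G.deleteEdges {s(r, c)}).valency w = G.valency w := by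
  unfold valency
  congr 1
  ext x
  simp [hr, hc]

lemma card_component_le {G : SimpleGraph V} (r c : V) :
    (G.component r).card ≤ ((G.deleteEdges {s(r, c)}).component r).card +
      ((G.deleteEdges {s(r, c)}).component c).card := by
  refine (card_le_card fun w hw => ?_).trans (card_union_le _ _)
  simpa using reachable_deleteEdge (mem_component.1 hw)

lemma card_innerVertices_le {G : SimpleGraph V} {r c : V} (hadj : G.Adj r c)
    (hb : ¬ (G.deleteEdges {s(r, c)}).Reachable r c) :
    (G.innerVertices r).card ≤ ((G.deleteEdges {s(r, c)}).innerVertices r).card +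
      ((G.deleteEdges {s(r, c)}).innerVertices c).card +
        (if (G.deleteEdges {s(r, c)}).valency c = 0 then 0 else 1) := by
  have hval : G.valency c = (G.deleteEdges {s(r, c)}).valency c + 1 := by
    rw [Sym2.eq_swap]
    exact valency_eq_valency_deleteEdge_add_one hadj.symm
  have hsub : G.innerVertices r ⊆ (G.deleteEdges {s(r, c)}).innerVertices r ∪
      (G.deleteEdges {s(r, c)}).innerVertices c ∪
        (if (G.deleteEdges {s(r, c)}).valency c = 0 then ∅ else {c}) := by
    intro w hw
    simp only [innerVertices, mem_filter, mem_univ, true_and] at hw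
    obtain ⟨hrw, hne, hv⟩ := hw
    by_cases hwc : w = c
    · subst hwc
      have : (G.deleteEdges {s(r, w)}).valency w ≠ 0 := by omega
      simp [this]
    · have := reachable_deleteEdge (c := c) hrw
      rw [← valency_deleteEdge_of_ne hne hwc] at hv
      simp only [innerVertices, mem_union, mem_filter, mem_univ, true_and]
      tauto
  refine (card_le_card hsub).trans ((card_union_le _ _).trans ?_)
  refine add_le_add (card_union_le _ _) ?_
  split_ifs <;> simp

/-- The estimates on a rooted tree with root degree `d`, `N` subtrees at the root, average
subtree order `L`, `n` vertices and `k` internal vertices besides the root. -/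
structure RootedBounds (d : ℕ) (N L n k : ℚ) : Prop where
  one_le : 1 ≤ N
  lower : (n + 1) / 2 + k / 10 ≤ L
  upper : L ≤ (N + 1) / 2
  two_le : 1 ≤ d → 2 ≤ N
  upper_of_two_le : 2 ≤ d → L ≤ 2 / 5 * (N + 1)
  of_zero : d = 0 → N = 1 ∧ L = 1 ∧ n = 1 ∧ k = 0

lemma RootedBounds.glue {d₁ d₂ : ℕ} {N₁ N₂ L₁ L₂ n₁ n₂ k₁ k₂ n k : ℚ}
    (h₁ : RootedBounds d₁ N₁ L₁ n₁ k₁) (h₂ : RootedBounds d₂ N₂ L₂ n₂ k₂) (hd : d₂ ≠ 1)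
    (hn : n ≤ n₁ + n₂) (hk : k ≤ k₁ + k₂ + if d₂ = 0 then 0 else 1) :
    RootedBounds (d₁ + 1) (N₁ * (1 + N₂)) (L₁ + N₂ / (1 + N₂) * L₂) n k := by
  obtain ⟨a1, a2, a3, a4, a5, a6⟩ := h₁
  obtain ⟨b1, b2, b3, b4, b5, b6⟩ := h₂
  have hpos : (0 : ℚ) < 1 + N₂ := by linarith
  have hup : N₂ / (1 + N₂) * L₂ ≤ N₂ / 2 := by
    rw [div_mul_eq_mul_div, div_le_iff₀ hpos]
    nlinarith
  have hprod : N₁ * (1 + N₂) = N₁ + N₁ * N₂ := by ring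
  have h11 : 0 ≤ (N₁ - 1) * (N₂ - 1) := mul_nonneg (by linarith) (by linarith)
  have hlow : (n₂ / 2 + k₂ / 10 + if d₂ = 0 then 0 else 1 / 10) ≤ N₂ / (1 + N₂) * L₂ := by
    by_cases h0 : d₂ = 0
    · obtain ⟨rfl, rfl, rfl, rfl⟩ := b6 h0
      norm_num [h0]
    · have h5 := b5 (by omega)
      have : N₂ / (1 + N₂) * L₂ = L₂ - L₂ / (1 + N₂) := by field_simp; ring
      have h6 : L₂ / (1 + N₂) ≤ 2 / 5 := by
        rw [div_le_iff₀ hpos]; linarith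
      rw [this, if_neg h0]
      linarith
  refine ⟨by nlinarith, ?_, ?_, ?_, ?_, by simp⟩
  · split_ifs at hk hlow <;> linarith
  · nlinarith
  · intro _
    nlinarith
  · intro hd1
    by_cases h1 : d₁ = 1
    · have := a4 (by omega)
      have h21 : 0 ≤ (N₁ - 2) * (N₂ - 1) := mul_nonneg (by linarith) (by linarith)
      linarith
    · have := a5 (by omega)
      have := a4 (by omega)
      have h21 : 0 ≤ (N₁ - 2) * N₂ := mul_nonneg (by linarith) (by linarith)
      linarith

lemma glued_mean_eq {N₁ N₂ : ℚ} (S₁ S₂ : ℚ) (h₁ : 0 < N₁) (h₂ : 0 < N₂) :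
    (S₁ * (1 + N₂) + N₁ * S₂) / (N₁ * (1 + N₂)) = S₁ / N₁ + N₂ / (1 + N₂) * (S₂ / N₂) := by
  have : 0 < 1 + N₂ := by linarith
  field_simp

/-- The average order of the subtrees containing `r`. -/
noncomputable def rootedMean (G : SimpleGraph V) (r : V) : ℚ :=
  (∑ s ∈ G.rootedSubtrees r, (s.card : ℚ)) / (G.rootedSubtrees r).card

lemma eq_of_reachable_of_valency_eq_zero {G : SimpleGraph V} {r w : V}
    (h0 : G.valency r = 0) (h : G.Reachable r w) : w = r := by
  rw [reachable_iff_reflTransGen] at h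
  rcases h.cases_head with h | ⟨x, hx, -⟩
  · exact h.symm
  · rw [valency, card_eq_zero, filter_eq_empty_iff] at h0
    exact absurd hx (h0 (mem_univ x))

lemma rootedBounds_of_valency_eq_zero {G : SimpleGraph V} {r : V} (h0 : G.valency r = 0) :
    RootedBounds (G.valency r) (G.rootedSubtrees r).card (G.rootedMean r)
      (G.component r).card (G.innerVertices r).card := by
  have heq : ∀ w, G.Reachable r w → w = r := fun w => eq_of_reachable_of_valency_eq_zero h0
  have hF : G.rootedSubtrees r = {{r}} := by
    ext s
    rw [mem_rootedSubtrees, mem_singleton]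
    constructor
    · intro hs
      exact eq_singleton_iff_unique_mem.2 ⟨hs.1, fun w hw => heq w (hs.reachable hw)⟩
    · rintro rfl
      refine ⟨mem_singleton_self r, fun w hw => ?_⟩
      rw [mem_singleton.1 hw]
  have hn : G.component r = {r} := by
    ext w
    rw [mem_component, mem_singleton]
    exact ⟨heq w, by rintro rfl; exact Reachable.refl _⟩
  have hk : G.innerVertices r = ∅ := by
    rw [innerVertices, filter_eq_empty_iff]
    exact fun w _ h => h.2.1 (heq w h.1)
  rw [h0, rootedMean, hF, hn, hk]
  constructor <;> norm_num

/-- The estimates hold in a forest in which no vertex of the component of `r`, except perhaps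
`r` itself, has exactly two neighbours. -/
theorem rootedBounds_of_isAcyclic (G : SimpleGraph V) (r : V) (hG : G.IsAcyclic)
    (hdeg : ∀ w, G.Reachable r w → w ≠ r → G.valency w ≠ 2) :
    RootedBounds (G.valency r) (G.rootedSubtrees r).card (G.rootedMean r)
      (G.component r).card (G.innerVertices r).card := by
  induction G using WellFoundedLT.induction generalizing r with
  | ind G ih =>
  by_cases h0 : G.valency r = 0
  · exact rootedBounds_of_valency_eq_zero h0
  obtain ⟨c, hc⟩ := card_pos.1 (Nat.pos_of_ne_zero h0)
  have hadj : G.Adj r c := (mem_filter.1 hc).2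
  have hb : ¬ (G.deleteEdges {s(r, c)}).Reachable r c :=
    isBridge_iff.1 (isAcyclic_iff_forall_adj_isBridge.1 hG hadj)
  have hvr := valency_eq_valency_deleteEdge_add_one hadj
  have hvc : G.valency c = (G.deleteEdges {s(r, c)}).valency c + 1 := by
    rw [Sym2.eq_swap]
    exact valency_eq_valency_deleteEdge_add_one hadj.symm
  have hN := card_rootedSubtrees hadj hb
  have hS := sum_card_rootedSubtrees hadj hb
  have hn := card_component_le (G := G) r c
  have hk := card_innerVertices_le hadj hb
  have hle : G.deleteEdges {s(r, c)} ≤ G := deleteEdges_le _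
  have hlt : G.deleteEdges {s(r, c)} < G := by
    refine lt_of_le_of_ne hle fun h => ?_
    rw [h] at hb
    exact hb hadj.reachable
  have hval : ∀ w, w ≠ r → w ≠ c → (G.deleteEdges {s(r, c)}).valency w = G.valency w :=
    fun w => valency_deleteEdge_of_ne
  have hc2 := hdeg c hadj.reachable hadj.ne'
  set H := G.deleteEdges {s(r, c)}
  have h₁ := ih H hlt r (hG.anti hle) fun w hrw hne => by
    rw [hval w hne (by rintro rfl; exact hb hrw)]
    exact hdeg w (hrw.mono hle) hne
  have h₂ := ih H hlt c (hG.anti hle) fun w hcw hne => by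
    have hwr : w ≠ r := by rintro rfl; exact hb hcw.symm
    rw [hval w hwr hne]
    exact hdeg w (hadj.reachable.trans (hcw.mono hle)) hwr
  have hN₁ := h₁.one_le
  have hN₂ := h₂.one_le
  have hL : G.rootedMean r = H.rootedMean r +
      (H.rootedSubtrees c).card / (1 + (H.rootedSubtrees c).card) * H.rootedMean c := by
    rw [rootedMean, hN, hS, rootedMean, rootedMean]
    exact glued_mean_eq _ _ (by linarith) (by linarith)
  rw [hvr, hN, hL]
  refine h₁.glue h₂ (by omega) (by exact_mod_cast hn) ?_
  have : ((G.innerVertices r).card : ℚ) ≤ ((H.innerVertices r).card +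
      (H.innerVertices c).card + (if H.valency c = 0 then 0 else 1) : ℕ) := by exact_mod_cast hk
  simpa using this

lemma degree_eq_valency (G : SimpleGraph V) (w : V) : G.degree w = G.valency w := by
  rw [valency, ← card_neighborFinset_eq_degree]
  congr 1
  ext x
  simp

lemma lambdaV_eq_rootedMean (G : SimpleGraph V) (v : V) : lambdaV G v = G.rootedMean v := by
  have : (subtreeFinset G).filter (fun s => v ∈ s) = G.rootedSubtrees v := by
    ext s
    rw [mem_rootedSubtrees, ← isSubtree_and_mem_iff]
    simp [subtreeFinset]
  rw [lambdaV, this, rootedMean]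

end SimpleGraph

/-- If `T ∈ 𝒯₃*` has root `v` and `n` vertices of which `k` are not leaves, then
`λ(T,v) ≥ (n+1)/2 + (k-1)/10`. -/
theorem lambda_ge_of_inT3Star {V : Type*} [Fintype V] (G : SimpleGraph V) (v : V)
    (h : InT3Star G v) (k : ℕ)
    (hk : k = (Finset.univ.filter (fun w => ¬ G.degree w = 1)).card) :
    ((Fintype.card V : ℚ) + 1) / 2 + ((k : ℚ) - 1) / 10 ≤ lambdaV G v := by
  obtain ⟨hT, h⟩ := h
  have hdeg : ∀ w, G.Reachable v w → w ≠ v → G.valency w ≠ 2 := by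
    intro w _ hne h2
    rcases h with h | h
    · exact hne (Fintype.card_le_one_iff.1 h.le w v)
    · have := h.2 w hne
      rw [G.degree_eq_valency] at this
      omega
  have hreach : ∀ w, G.Reachable v w := fun w => hT.1.preconnected v w
  have hn : (G.component v).card = Fintype.card V := by
    rw [← card_univ]
    congr 1
    ext w
    simp [hreach w]
  have hk' : k ≤ (G.innerVertices v).card + 1 := by
    rw [hk, ← card_singleton v]
    refine (card_le_card fun w hw => ?_).trans (card_union_le _ _)
    simp only [mem_filter, mem_univ, true_and, G.degree_eq_valency] at hw
    simp only [SimpleGraph.innerVertices, mem_union, mem_filter, mem_univ, true_and,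
      mem_singleton]
    have := hreach w
    tauto
  have hlow := (G.rootedBounds_of_isAcyclic v hT.2 hdeg).lower
  have hk'' : (k : ℚ) ≤ (G.innerVertices v).card + 1 := by exact_mod_cast hk'
  rw [G.lambdaV_eq_rootedMean, ← hn]
  linarith
end

section
/- Let (T_i)_{i≥0} be a sequence of pairwise distinct (non-isomorphic) trees in 𝒯₃, where T_i has n_i vertices and l_i leaves. Then D(T_i) → 1/2 as i → ∞ if and only if l_i/n_i → 1 as i → ∞. -/
open SimpleGraph Finset BigOperators Filter

attribute [local instance] Classical.propDecidable

/-- The number of leaves (vertices of degree one) of `G`. -/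
noncomputable def numLeaves {V : Type*} [Fintype V] (G : SimpleGraph V) : ℕ :=
  (Finset.univ.filter (fun v => G.degree v = 1)).card

open Relation

namespace SimpleGraph

variable {V : Type*} {G : SimpleGraph V}

/-- Adjacency between two vertices of `S`. -/
def AdjWithin (G : SimpleGraph V) (S : Finset V) (a b : V) : Prop :=
  G.Adj a b ∧ a ∈ S ∧ b ∈ S

theorem AdjWithin.mono {S T : Finset V} (h : S ⊆ T) {a b : V} (hab : G.AdjWithin S a b) :
    G.AdjWithin T a b :=
  ⟨hab.1, h hab.2.1, h hab.2.2⟩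

theorem isSubtree_iff {S : Finset V} {p : V} (hp : p ∈ S) :
    G.IsSubtree S ↔ ∀ x ∈ S, ReflTransGen (G.AdjWithin S) x p := by
  constructor
  · rintro ⟨_, hc⟩ x hx
    have h := (reachable_iff_reflTransGen _ _).1 (hc.preconnected ⟨x, hx⟩ ⟨p, hp⟩)
    exact ReflTransGen.lift (p := G.AdjWithin S) Subtype.val
      (fun a b hab => ⟨hab, a.2, b.2⟩) _ _ h
  · intro h
    refine ⟨⟨p, hp⟩, (connected_iff_exists_forall_reachable _).2 ⟨⟨p, hp⟩, ?_⟩⟩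
    rintro ⟨x, hx⟩
    refine Reachable.symm ?_
    have key : ∀ y, ReflTransGen (G.AdjWithin S) y p → ∀ hy : y ∈ S,
        (G.induce (S : Set V)).Reachable ⟨y, hy⟩ ⟨p, hp⟩ := by
      intro y hyp
      induction hyp using ReflTransGen.head_induction_on with
      | refl => intro _; rfl
      | head hab _ ih =>
        intro hy
        exact (Adj.reachable (G := G.induce (S : Set V)) (u := ⟨_, hy⟩)
          (v := ⟨_, hab.2.2⟩) hab.1).trans (ih hab.2.2)
    exact key x (h x hx) hx

theorem isSubtree_singleton (x : V) : G.IsSubtree {x} := by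
  refine (isSubtree_iff (mem_singleton_self x)).2 fun y hy => ?_
  rw [mem_singleton.1 hy]

theorem IsSubtree.union_of_adj_s16 {S T : Finset V} {v p : V} (hS : G.IsSubtree S)
    (hT : G.IsSubtree T) (hv : v ∈ S) (hp : p ∈ T) (h : G.Adj v p) :
    G.IsSubtree (S ∪ T) := by
  refine (isSubtree_iff (mem_union_right S hp)).2 fun x hx => ?_
  rcases mem_union.1 hx with hx | hx
  · exact (ReflTransGen.mono (fun _ _ => AdjWithin.mono subset_union_left) _ _
      ((isSubtree_iff hv).1 hS x hx)).tail
        ⟨h, mem_union_left _ hv, mem_union_right _ hp⟩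
  · exact ReflTransGen.mono (fun _ _ => AdjWithin.mono subset_union_right) _ _
      ((isSubtree_iff hp).1 hT x hx)

theorem IsSubtree.insert_of_adj_s16 {S : Finset V} {x u : V} (hS : G.IsSubtree S) (hu : u ∈ S)
    (h : G.Adj x u) : G.IsSubtree (insert x S) := by
  rw [insert_eq]
  exact (isSubtree_singleton x).union_of_adj_s16 hS (mem_singleton_self x) hu h

theorem eq_of_adj_of_degree_eq_one [Fintype V] {a b c : V} (h : G.degree a = 1)
    (hb : G.Adj a b) (hc : G.Adj a c) : b = c :=
  (degree_eq_one_iff_existsUnique_adj.1 h).unique hb hc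

/-- Removing leaves from a subtree leaves a subtree, unless nothing is left. -/
theorem IsSubtree.sdiff_leaves [Fintype V] {S L : Finset V} {p : V} (hS : G.IsSubtree S)
    (hpS : p ∈ S) (hpL : p ∉ L) (hL : ∀ a ∈ L, G.degree a = 1) : G.IsSubtree (S \ L) := by
  have hp : p ∈ S \ L := mem_sdiff.2 ⟨hpS, hpL⟩
  have key : ∀ a, ReflTransGen (G.AdjWithin S) a p →
      (a ∉ L → ReflTransGen (G.AdjWithin (S \ L)) a p) ∧
      (a ∈ L → ∃ c, c ∉ L ∧ G.Adj a c ∧ ReflTransGen (G.AdjWithin (S \ L)) c p) := by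
    intro a ha
    induction ha using ReflTransGen.head_induction_on with
    | refl => exact ⟨fun _ => .refl, fun h => absurd h hpL⟩
    | @head a y hay _ ih =>
      refine ⟨fun haL => ?_, fun haL => ?_⟩
      · by_cases hy : y ∈ L
        · obtain ⟨c, _, hyc, hc⟩ := ih.2 hy
          rwa [eq_of_adj_of_degree_eq_one (hL y hy) hay.1.symm hyc]
        · exact (ih.1 hy).head ⟨hay.1, mem_sdiff.2 ⟨hay.2.1, haL⟩, mem_sdiff.2 ⟨hay.2.2, hy⟩⟩
      · by_cases hy : y ∈ L
        · obtain ⟨c, hcL, hyc, _⟩ := ih.2 hy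
          exact absurd (eq_of_adj_of_degree_eq_one (hL y hy) hay.1.symm hyc ▸ haL) hcL
        · exact ⟨y, hy, hay.1, ih.1 hy⟩
  refine (isSubtree_iff hp).2 fun x hx => ?_
  exact (key x ((isSubtree_iff hpS).1 hS x (mem_sdiff.1 hx).1)).1 (mem_sdiff.1 hx).2

/-- The vertices on the side of `p` when the edge `pv` is removed. -/
noncomputable def branch [Fintype V] (G : SimpleGraph V) (p v : V) : Finset V :=
  univ.filter fun x => (G.deleteEdges {s(p, v)}).Reachable x p

section Branch

variable [Fintype V]

theorem mem_branch {p v x : V} :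
    x ∈ G.branch p v ↔ (G.deleteEdges {s(p, v)}).Reachable x p := by
  simp [branch]

theorem self_mem_branch (p v : V) : p ∈ G.branch p v :=
  mem_branch.2 (Reachable.refl p)

theorem mem_branch_of_adj {p v x y : V} (hxy : G.Adj x y) (he : s(x, y) ≠ s(p, v))
    (hy : y ∈ G.branch p v) : x ∈ G.branch p v := by
  have h : (G.deleteEdges {s(p, v)}).Adj x y := deleteEdges_adj.2 ⟨hxy, he⟩
  exact mem_branch.2 (h.reachable.trans (mem_branch.1 hy))

theorem isSubtree_branch (p v : V) : G.IsSubtree (G.branch p v) := by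
  refine (isSubtree_iff (self_mem_branch p v)).2 fun x hx => ?_
  have h := (reachable_iff_reflTransGen _ _).1 (mem_branch.1 hx)
  clear hx
  induction h using ReflTransGen.head_induction_on with
  | refl => exact .refl
  | head hab hb ih =>
    have hb' := mem_branch.2 ((reachable_iff_reflTransGen _ _).2 hb)
    have hab' := deleteEdges_adj.1 hab
    exact ih.head ⟨hab'.1, mem_branch_of_adj hab'.1 hab'.2 hb', hb'⟩

theorem IsTree.notMem_branch (hG : G.IsTree) {p v : V} (h : G.Adj p v) :
    v ∉ G.branch p v := by
  have := isBridge_iff.1 (isAcyclic_iff_forall_adj_isBridge.1 hG.isAcyclic h)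
  exact fun hv => this (mem_branch.1 hv).symm

theorem IsSubtree.disjoint_branch (hG : G.IsTree) {S : Finset V} (hS : G.IsSubtree S) {p v : V}
    (h : G.Adj p v) (hv : v ∈ S) (hp : p ∉ S) : Disjoint S (G.branch p v) := by
  refine Finset.disjoint_left.2 fun x hx hxb => ?_
  have key : ∀ y, ReflTransGen (G.AdjWithin S) y v → y ∉ G.branch p v := by
    intro y hy
    induction hy using ReflTransGen.head_induction_on with
    | refl => exact hG.notMem_branch h
    | @head a b hab _ ih =>
      refine fun ha => ih (mem_branch_of_adj hab.1.symm ?_ ha)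
      rintro he
      have : p ∈ s(b, a) := he ▸ Sym2.mem_mk_left p v
      rcases Sym2.mem_iff.1 this with rfl | rfl
      exacts [hp hab.2.2, hp hab.2.1]
  exact key x ((isSubtree_iff hv).1 hS x hx) hxb

/-- A path from `x` to a set `S` avoiding `x` has a first edge entering `S`. -/
theorem Connected.exists_adj_mem_branch (hG : G.Connected) {S : Finset V} (hS : S.Nonempty)
    {x : V} (hx : x ∉ S) : ∃ p v, G.Adj p v ∧ p ∉ S ∧ v ∈ S ∧ x ∈ G.branch p v := by
  obtain ⟨s, hs⟩ := hS
  have h := (reachable_iff_reflTransGen _ _).1 (hG.preconnected x s)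
  induction h using ReflTransGen.head_induction_on with
  | refl => exact absurd hs hx
  | @head a b hab _ ih =>
    by_cases hb : b ∈ S
    · exact ⟨a, b, hab, hx, hb, self_mem_branch a b⟩
    · obtain ⟨p, v, hpv, hp, hv, hbv⟩ := ih hb
      refine ⟨p, v, hpv, hp, hv, mem_branch_of_adj hab ?_ hbv⟩
      intro he
      have : v ∈ s(a, b) := he ▸ Sym2.mem_mk_right p v
      rcases Sym2.mem_iff.1 this with rfl | rfl
      exacts [hx hv, hb hv]

theorem Connected.mem_branch_or_mem_branch (hG : G.Connected) (x p : V) {v w : V} (h : v ≠ w) :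
    x ∈ G.branch p v ∨ x ∈ G.branch p w := by
  have hr := (reachable_iff_reflTransGen _ _).1 (hG.preconnected x p)
  induction hr using ReflTransGen.head_induction_on with
  | refl => exact .inl (self_mem_branch p v)
  | @head a b hab _ ih =>
    by_cases hav : s(a, b) = s(p, v)
    · by_cases haw : s(a, b) = s(p, w)
      · exact absurd (Sym2.congr_right.1 (hav.symm.trans haw)) h
      · rcases Sym2.eq_iff.1 hav with ⟨rfl, rfl⟩ | ⟨rfl, rfl⟩
        · exact .inl (self_mem_branch _ _)
        · exact .inr (mem_branch_of_adj hab haw (self_mem_branch _ _))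
    · by_cases haw : s(a, b) = s(p, w)
      · rcases Sym2.eq_iff.1 haw with ⟨rfl, rfl⟩ | ⟨rfl, rfl⟩
        · exact .inl (self_mem_branch _ _)
        · exact .inl (mem_branch_of_adj hab hav (self_mem_branch _ _))
      · exact ih.imp (mem_branch_of_adj hab hav) (mem_branch_of_adj hab haw)

end Branch

/-- The degree sum within a subtree. -/
theorem IsSubtree.sum_card_filter_adj [Fintype V] (hG : G.IsTree) {S : Finset V}
    (hS : G.IsSubtree S) : ∑ x ∈ S, (S.filter (G.Adj x)).card + 2 = 2 * S.card := by
  have ht : (G.induce (S : Set V)).IsTree := ⟨hS.2, hG.isAcyclic.induce _⟩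
  have h1 := ht.card_edgeFinset
  have h2 := (G.induce (S : Set V)).sum_degrees_eq_twice_card_edges
  have h3 : Fintype.card (S : Set V) = S.card := by simp
  have h4 : ∑ x ∈ S, (S.filter (G.Adj x)).card = ∑ x, (G.induce (S : Set V)).degree x := by
    rw [← Finset.sum_coe_sort S]
    refine Finset.sum_congr rfl fun x _ => ?_
    rw [← card_neighborFinset_eq_degree]
    refine (Finset.card_bij (fun y _ => y.1) ?_ ?_ ?_).symm
    · intro y hy
      simp only [mem_neighborFinset] at hy
      exact mem_filter.2 ⟨y.2, hy⟩
    · intro a _ b _ h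
      exact Subtype.ext h
    · intro b hb
      obtain ⟨hb, hxb⟩ := mem_filter.1 hb
      exact ⟨⟨b, hb⟩, by simpa using hxb, rfl⟩
  omega

end SimpleGraph

namespace SimpleGraph

variable {V : Type*} [Fintype V] {G : SimpleGraph V}

/-- A leaf has weight `1`, every other vertex has weight `2`. -/
noncomputable def vertexWeight (G : SimpleGraph V) (x : V) : ℕ :=
  if G.degree x = 1 then 1 else 2

/-- The number of vertices that are not leaves. -/
noncomputable def numNonLeaves (G : SimpleGraph V) : ℕ :=
  (univ.filter fun x => G.degree x ≠ 1).card

theorem sum_vertexWeight (C : Finset V) :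
    ∑ x ∈ C, G.vertexWeight x =
      (C.filter fun x => G.degree x = 1).card + 2 * (C.filter fun x => G.degree x ≠ 1).card := by
  simp only [vertexWeight, Finset.sum_ite, Finset.sum_const, smul_eq_mul, ne_eq]
  omega

theorem card_filter_degree_eq_one_add (C : Finset V) :
    (C.filter fun x => G.degree x = 1).card + (C.filter fun x => G.degree x ≠ 1).card = C.card :=
  card_filter_add_card_filter_not _

theorem numLeaves_add_numNonLeaves : numLeaves G + G.numNonLeaves = Fintype.card V :=
  card_filter_degree_eq_one_add univ

theorem le_sum_degree (h3 : ∀ x, G.degree x ≠ 1 → 3 ≤ G.degree x) (C : Finset V) :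
    (C.filter fun x => G.degree x = 1).card + 3 * (C.filter fun x => G.degree x ≠ 1).card ≤
      ∑ x ∈ C, G.degree x := by
  calc _ = ∑ x ∈ C, (if G.degree x = 1 then 1 else 3) := by
        simp only [Finset.sum_ite, Finset.sum_const, smul_eq_mul, ne_eq]
        omega
    _ ≤ _ := by
        refine Finset.sum_le_sum fun x _ => ?_
        split_ifs with h
        exacts [h.ge, h3 x h]

theorem IsTree.numNonLeaves_le (hG : G.IsTree) (h3 : ∀ x, G.degree x ≠ 1 → 3 ≤ G.degree x) :
    G.numNonLeaves ≤ numLeaves G := by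
  have h1 := le_sum_degree h3 univ
  have h2 := hG.card_edgeFinset
  have h4 := G.sum_degrees_eq_twice_card_edges
  have h5 := G.numLeaves_add_numNonLeaves
  simp only [numLeaves, numNonLeaves] at *
  omega

theorem IsTree.card_nonLeaves_branch_lt (hG : G.IsTree)
    (h3 : ∀ x, G.degree x ≠ 1 → 3 ≤ G.degree x) {p v : V} (h : G.Adj p v) :
    ((G.branch p v).filter fun x => G.degree x ≠ 1).card <
      ((G.branch p v).filter fun x => G.degree x = 1).card := by
  have h1 := le_sum_degree h3 (G.branch p v)
  have h2 := (G.isSubtree_branch p v).sum_card_filter_adj hG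
  have h4 : ∑ x ∈ G.branch p v, G.degree x ≤
      ∑ x ∈ G.branch p v, (((G.branch p v).filter (G.Adj x)).card + if x = p then 1 else 0) := by
    refine Finset.sum_le_sum fun x hx => ?_
    rw [← card_neighborFinset_eq_degree]
    have hsub : G.neighborFinset x ⊆
        (G.branch p v).filter (G.Adj x) ∪ if x = p then {v} else ∅ := by
      intro y hy
      have hxy : G.Adj x y := by simpa using hy
      by_cases he : s(y, x) = s(p, v)
      · rcases Sym2.eq_iff.1 he with ⟨rfl, rfl⟩ | ⟨rfl, rfl⟩
        · exact mem_union_left _ (mem_filter.2 ⟨self_mem_branch _ _, hxy⟩)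
        · exact mem_union_right _ (by simp)
      · exact mem_union_left _ (mem_filter.2 ⟨mem_branch_of_adj hxy.symm he hx, hxy⟩)
    refine (card_le_card hsub).trans ((card_union_le _ _).trans ?_)
    split_ifs <;> simp
  have h5 := G.card_filter_degree_eq_one_add (G.branch p v)
  rw [Finset.sum_add_distrib, Finset.sum_ite_eq' (G.branch p v) p,
    if_pos (self_mem_branch p v)] at h4
  omega

/-- The subtrees containing `v` but not `p`. -/
noncomputable def crossing (G : SimpleGraph V) (p v : V) : Finset (Finset V) :=
  (subtreeFinset G).filter fun S => v ∈ S ∧ p ∉ S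

theorem mem_subtreeFinset {S : Finset V} : S ∈ subtreeFinset G ↔ G.IsSubtree S := by
  simp [subtreeFinset]

theorem IsTree.card_crossing_mul_le (hG : G.IsTree) {p v : V} (h : G.Adj p v)
    (hp : G.degree p ≠ 1) :
    (G.crossing p v).card * (1 + 2 ^ ((G.branch p v).filter fun x => G.degree x = 1).card) ≤
      (subtreeFinset G).card := by
  set C := G.branch p v
  set L := C.filter fun x => G.degree x = 1
  have h1 : (G.crossing p v).card ≤ ((subtreeFinset G).filter fun S => ¬ p ∈ S).card := by
    refine card_le_card fun S hS => ?_
    obtain ⟨hS, hv, hp⟩ := mem_filter.1 hS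
    exact mem_filter.2 ⟨hS, hp⟩
  have hdisj : ∀ S ∈ G.crossing p v, Disjoint S C := by
    intro S hS
    obtain ⟨hS, hv, hp⟩ := mem_filter.1 hS
    exact (mem_subtreeFinset.1 hS).disjoint_branch hG h hv hp
  have h2 : (G.crossing p v).card * 2 ^ L.card ≤
      ((subtreeFinset G).filter fun S => p ∈ S).card := by
    rw [← card_powerset, ← card_product]
    refine card_le_card_of_injOn (fun x => x.1 ∪ C \ x.2) ?_ ?_
    · rintro ⟨S, F⟩ hSF
      obtain ⟨hS, hF⟩ := mem_product.1 (mem_coe.1 hSF)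
      obtain ⟨hS, hv, -⟩ := mem_filter.1 hS
      have hF' := mem_powerset.1 hF
      have hpF : p ∉ F := fun hpF => hp (mem_filter.1 (hF' hpF)).2
      have hpC : p ∈ C := self_mem_branch p v
      have hp' : p ∈ C \ F := mem_sdiff.2 ⟨hpC, hpF⟩
      refine mem_coe.2 (mem_filter.2 ⟨mem_subtreeFinset.2 ?_, mem_union_right _ hp'⟩)
      exact (mem_subtreeFinset.1 hS).union_of_adj_s16
        ((isSubtree_branch p v).sdiff_leaves hpC hpF fun a ha => (mem_filter.1 (hF' ha)).2)
        hv hp' h.symm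
    · rintro ⟨S, F⟩ hSF ⟨S', F'⟩ hSF' heq
      obtain ⟨hS, hF⟩ := mem_product.1 (mem_coe.1 hSF)
      obtain ⟨hS', hF'⟩ := mem_product.1 (mem_coe.1 hSF')
      have hd := Finset.disjoint_left.1 (hdisj S hS)
      have hd' := Finset.disjoint_left.1 (hdisj S' hS')
      have hFC : F ⊆ C := (mem_powerset.1 hF).trans (filter_subset _ _)
      have hFC' : F' ⊆ C := (mem_powerset.1 hF').trans (filter_subset _ _)
      have hx : ∀ x, (x ∈ S ∨ x ∈ C ∧ x ∉ F) ↔ (x ∈ S' ∨ x ∈ C ∧ x ∉ F') := by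
        intro x
        simpa using Finset.ext_iff.1 heq x
      refine Prod.ext (Finset.ext fun x => ?_) (Finset.ext fun x => ?_)
      · have h5 := hx x
        have h6 := @hd x
        have h7 := @hd' x
        clear * - h5 h6 h7
        tauto
      · have h5 := hx x
        have h6 := @hd x
        have h7 := @hd' x
        have h8 := @hFC x
        have h9 := @hFC' x
        clear * - h5 h6 h7 h8 h9
        tauto
  have h4 := card_filter_add_card_filter_not (s := subtreeFinset G) (fun S => p ∈ S)
  rw [mul_add, mul_one]
  omega

theorem five_mul_le_two_pow {m : ℕ} (hm : 2 ≤ m) : 5 * (3 * m - 2) ≤ 4 * (1 + 2 ^ m) := by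
  suffices 15 * m ≤ 14 + 4 * 2 ^ m by omega
  rcases hm.eq_or_lt with rfl | hm'
  · norm_num
  · clear hm
    induction m, hm' using Nat.le_induction with
    | base => norm_num
    | succ m hm ih =>
      have : 2 ^ 3 ≤ 2 ^ m := Nat.pow_le_pow_right (by norm_num) hm
      rw [pow_succ]
      omega

theorem cube_le_two_pow {m : ℕ} (hm : 30 ≤ m) : 480 * m ^ 3 ≤ 2 ^ m := by
  induction m, hm using Nat.le_induction with
  | base => norm_num
  | succ m hm ih =>
    rw [pow_succ 2]
    nlinarith [Nat.mul_le_mul hm (Nat.mul_le_mul hm (le_refl m)),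
      Nat.mul_le_mul hm (le_refl (m ^ 2))]

theorem IsTree.sum_vertexWeight_branch_le (hG : G.IsTree)
    (h3 : ∀ x, G.degree x ≠ 1 → 3 ≤ G.degree x) {p v : V} (h : G.Adj p v) (hp : G.degree p ≠ 1) :
    2 ≤ ((G.branch p v).filter fun x => G.degree x = 1).card ∧
    ∑ x ∈ G.branch p v, G.vertexWeight x ≤
      3 * ((G.branch p v).filter fun x => G.degree x = 1).card - 2 := by
  have h1 := hG.card_nonLeaves_branch_lt h3 h
  have h2 : 0 < ((G.branch p v).filter fun x => G.degree x ≠ 1).card :=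
    card_pos.2 ⟨p, mem_filter.2 ⟨self_mem_branch p v, hp⟩⟩
  rw [sum_vertexWeight]
  omega

theorem IsTree.five_mul_weight_mul_card_crossing_le (hG : G.IsTree)
    (h3 : ∀ x, G.degree x ≠ 1 → 3 ≤ G.degree x) {p v : V} (h : G.Adj p v)
    (hp : G.degree p ≠ 1) :
    5 * ((∑ x ∈ G.branch p v, G.vertexWeight x) * (G.crossing p v).card) ≤
      4 * (subtreeFinset G).card := by
  obtain ⟨h1, h2⟩ := hG.sum_vertexWeight_branch_le h3 h hp
  have h4 := five_mul_le_two_pow h1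
  have h5 := hG.card_crossing_mul_le h hp
  generalize ((G.branch p v).filter fun x => G.degree x = 1).card = m at *
  calc _ = (5 * ∑ x ∈ G.branch p v, G.vertexWeight x) * (G.crossing p v).card := by ring
    _ ≤ (4 * (1 + 2 ^ m)) * (G.crossing p v).card := Nat.mul_le_mul_right _ (by omega)
    _ = 4 * ((G.crossing p v).card * (1 + 2 ^ m)) := by ring
    _ ≤ _ := Nat.mul_le_mul_left _ h5

theorem IsTree.card_sq_mul_weight_mul_card_crossing_le (hG : G.IsTree)
    (h3 : ∀ x, G.degree x ≠ 1 → 3 ≤ G.degree x) (hn : 120 ≤ Fintype.card V) {p v : V}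
    (h : G.Adj p v) (hp : G.degree p ≠ 1)
    (hl : numLeaves G ≤ 2 * ((G.branch p v).filter fun x => G.degree x = 1).card) :
    Fintype.card V ^ 2 *
      (10 * ((∑ x ∈ G.branch p v, G.vertexWeight x) * (G.crossing p v).card)) ≤
      (subtreeFinset G).card := by
  obtain ⟨h1, h2⟩ := hG.sum_vertexWeight_branch_le h3 h hp
  have h5 := hG.card_crossing_mul_le h hp
  have h6 := hG.numNonLeaves_le h3
  have h7 := G.numLeaves_add_numNonLeaves
  generalize ((G.branch p v).filter fun x => G.degree x = 1).card = m at *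
  have h4 := cube_le_two_pow (m := m) (by omega)
  generalize (G.crossing p v).card = c at *
  calc _ ≤ (4 * m) ^ 2 * (10 * ((3 * m) * c)) := by
        gcongr
        · omega
        · omega
    _ = c * (480 * m ^ 3) := by ring
    _ ≤ c * (1 + 2 ^ m) := by gcongr; omega
    _ ≤ _ := h5

/-- The ordered pairs `(p, v)` of adjacent vertices in which `p` is not a leaf. -/
noncomputable def innerDarts (G : SimpleGraph V) : Finset (V × V) :=
  univ.filter fun d => G.Adj d.1 d.2 ∧ G.degree d.1 ≠ 1

end SimpleGraph

namespace SimpleGraph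

variable {V : Type*} [Fintype V] {G : SimpleGraph V}

/-- The subtrees which do not contain `x` and, if `x` is a leaf, cannot be extended by `x`. -/
noncomputable def farSubtrees (G : SimpleGraph V) (x : V) : Finset (Finset V) :=
  (subtreeFinset G).filter fun S => x ∉ S ∧ (G.degree x = 1 → ∀ u ∈ S, ¬ G.Adj x u)

theorem branch_eq_of_degree_eq_one {p v x : V} (hp : G.degree p = 1) (h : G.Adj p v)
    (hx : x ∈ G.branch p v) : x = p := by
  have hr := (reachable_iff_reflTransGen _ _).1 (mem_branch.1 hx)
  clear hx
  induction hr using ReflTransGen.head_induction_on with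
  | refl => rfl
  | @head a b hab _ ih =>
    obtain ⟨hadj, he⟩ := deleteEdges_adj.1 hab
    subst ih
    refine absurd ?_ he
    rw [eq_of_adj_of_degree_eq_one hp hadj.symm h, Set.mem_singleton_iff, Sym2.eq_swap]

theorem IsTree.card_farSubtrees_le (hG : G.IsTree) (x : V) :
    (G.farSubtrees x).card ≤
      ∑ d ∈ G.innerDarts, if x ∈ G.branch d.1 d.2 then (G.crossing d.1 d.2).card else 0 := by
  rw [← Finset.sum_filter]
  refine (card_le_card fun S hS => ?_).trans card_biUnion_le
  obtain ⟨hS, hx, hx'⟩ := mem_filter.1 hS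
  obtain ⟨p, v, hpv, hp, hv, hxb⟩ :=
    hG.connected.exists_adj_mem_branch (mem_subtreeFinset.1 hS).1 hx
  refine mem_biUnion.2 ⟨(p, v), mem_filter.2 ⟨mem_filter.2 ⟨mem_univ _, hpv, ?_⟩, hxb⟩,
    mem_filter.2 ⟨hS, hv, hp⟩⟩
  intro hdeg
  have := branch_eq_of_degree_eq_one hdeg hpv hxb
  subst this
  exact hx' hdeg v hv hpv

theorem IsTree.sum_vertexWeight_mul_card_farSubtrees_le (hG : G.IsTree) :
    ∑ x, G.vertexWeight x * (G.farSubtrees x).card ≤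
      ∑ d ∈ G.innerDarts,
        (∑ x ∈ G.branch d.1 d.2, G.vertexWeight x) * (G.crossing d.1 d.2).card := by
  calc _ ≤ ∑ x, G.vertexWeight x * ∑ d ∈ G.innerDarts,
          if x ∈ G.branch d.1 d.2 then (G.crossing d.1 d.2).card else 0 :=
        Finset.sum_le_sum fun x _ => Nat.mul_le_mul_left _ (hG.card_farSubtrees_le x)
    _ = _ := by
        simp_rw [Finset.mul_sum]
        rw [Finset.sum_comm]
        refine Finset.sum_congr rfl fun d _ => ?_
        simp [Finset.sum_mul, mul_ite, Finset.sum_ite_mem]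

theorem IsTree.sum_innerDarts_le (hG : G.IsTree) (h3 : ∀ x, G.degree x ≠ 1 → 3 ≤ G.degree x)
    (hk : 1 ≤ G.numNonLeaves) (hn : 120 ≤ Fintype.card V) :
    10 * ∑ d ∈ G.innerDarts,
        (∑ x ∈ G.branch d.1 d.2, G.vertexWeight x) * (G.crossing d.1 d.2).card ≤
      9 * G.numNonLeaves * (subtreeFinset G).card := by
  set N := (subtreeFinset G).card
  set f : V × V → ℕ := fun d =>
    (∑ x ∈ G.branch d.1 d.2, G.vertexWeight x) * (G.crossing d.1 d.2).card
  set big : V × V → Prop := fun d =>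
    numLeaves G ≤ 2 * ((G.branch d.1 d.2).filter fun x => G.degree x = 1).card with hbig
  have hinj : (G.innerDarts.filter fun d => ¬ big d).card ≤ G.numNonLeaves := by
    refine card_le_card_of_injOn Prod.fst ?_ ?_
    · intro d hd
      have := (mem_filter.1 (mem_filter.1 (mem_coe.1 hd)).1).2.2
      exact mem_coe.2 (mem_filter.2 ⟨mem_univ _, this⟩)
    · rintro ⟨p, v⟩ hd ⟨p', w⟩ hd' (rfl : p = p')
      by_contra hne
      have hvw : v ≠ w := fun h => hne (by rw [h])
      have h1 := (mem_filter.1 (mem_coe.1 hd)).2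
      have h2 := (mem_filter.1 (mem_coe.1 hd')).2
      have h4 : numLeaves G ≤ ((G.branch p v).filter fun x => G.degree x = 1).card +
          ((G.branch p w).filter fun x => G.degree x = 1).card := by
        refine (card_le_card fun x hx => ?_).trans (card_union_le _ _)
        rw [← filter_union]
        exact mem_filter.2 ⟨mem_union.2 (hG.connected.mem_branch_or_mem_branch x p hvw),
          (mem_filter.1 hx).2⟩
      simp only [hbig] at h1 h2
      omega
  have hsmall : 5 * ∑ d ∈ G.innerDarts.filter (fun d => ¬ big d), f d ≤
      G.numNonLeaves * (4 * N) := by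
    rw [Finset.mul_sum]
    refine (Finset.sum_le_card_nsmul _ _ (4 * N) fun d hd => ?_).trans
      (Nat.mul_le_mul_right _ hinj)
    obtain ⟨-, h, hp⟩ := mem_filter.1 (mem_filter.1 hd).1
    exact hG.five_mul_weight_mul_card_crossing_le h3 h hp
  have hlarge : 10 * ∑ d ∈ G.innerDarts.filter big, f d ≤ N := by
    have hpos : 0 < Fintype.card V ^ 2 := by positivity
    refine Nat.le_of_mul_le_mul_left ?_ hpos
    rw [Finset.mul_sum, Finset.mul_sum]
    refine (Finset.sum_le_card_nsmul _ _ N fun d hd => ?_).trans (Nat.mul_le_mul_right _ ?_)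
    · obtain ⟨hd, hl⟩ := mem_filter.1 hd
      obtain ⟨-, h, hp⟩ := mem_filter.1 hd
      exact hG.card_sq_mul_weight_mul_card_crossing_le h3 hn h hp hl
    · exact (card_le_univ _).trans (by rw [Fintype.card_prod, sq])
  rw [← Finset.sum_filter_add_sum_filter_not G.innerDarts big f]
  nlinarith

theorem sum_card_subtreeFinset :
    ∑ S ∈ subtreeFinset G, S.card = ∑ x, ((subtreeFinset G).filter fun S => x ∈ S).card := by
  simp_rw [Finset.card_filter, Finset.card_eq_sum_ones, ← Finset.sum_filter]
  rw [Finset.sum_comm' (t' := univ) (s' := fun x => (subtreeFinset G).filter fun S => x ∈ S)]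
  simp

theorem vertexWeight_mul_card_le (x : V) :
    G.vertexWeight x * (subtreeFinset G).card ≤
      2 * ((subtreeFinset G).filter fun S => x ∈ S).card +
        G.vertexWeight x * (G.farSubtrees x).card := by
  have h1 := card_filter_add_card_filter_not (s := subtreeFinset G) (fun S => x ∈ S)
  by_cases hx : G.degree x = 1
  · have h2 : ((subtreeFinset G).filter fun S => ¬ x ∈ S).card ≤
        ((subtreeFinset G).filter fun S => x ∈ S).card + (G.farSubtrees x).card := by
      rw [← card_filter_add_card_filter_not (s := (subtreeFinset G).filter fun S => ¬ x ∈ S)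
        (fun S => ∃ u ∈ S, G.Adj x u)]
      refine Nat.add_le_add ?_ (card_le_card fun S hS => ?_)
      · refine card_le_card_of_injOn (insert x) ?_ ?_
        · intro S hS
          obtain ⟨hS, u, hu, hxu⟩ := mem_filter.1 (mem_coe.1 hS)
          exact mem_coe.2 (mem_filter.2 ⟨mem_subtreeFinset.2
            ((mem_subtreeFinset.1 (mem_filter.1 hS).1).insert_of_adj_s16 hu hxu),
            mem_insert_self _ _⟩)
        · intro S hS T hT h
          have hS := (mem_filter.1 (mem_filter.1 (mem_coe.1 hS)).1).2
          have hT := (mem_filter.1 (mem_filter.1 (mem_coe.1 hT)).1).2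
          rw [← erase_insert hS, ← erase_insert hT]
          exact congrArg (fun U => U.erase x) h
      · obtain ⟨hS, hu⟩ := mem_filter.1 hS
        obtain ⟨hS, hxS⟩ := mem_filter.1 hS
        exact mem_filter.2 ⟨hS, hxS, fun _ u huS hxu => hu ⟨u, huS, hxu⟩⟩
    simp only [vertexWeight, if_pos hx]
    omega
  · have h2 : ((subtreeFinset G).filter fun S => ¬ x ∈ S).card ≤ (G.farSubtrees x).card :=
      card_le_card fun S hS => mem_filter.2
        ⟨(mem_filter.1 hS).1, (mem_filter.1 hS).2, fun h => absurd h hx⟩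
    simp only [vertexWeight, if_neg hx]
    omega

theorem two_mul_card_le_vertexWeight_mul_card_add (x : V) :
    2 * ((subtreeFinset G).filter fun S => x ∈ S).card ≤
      G.vertexWeight x * (subtreeFinset G).card + 1 := by
  have h1 := card_filter_add_card_filter_not (s := subtreeFinset G) (fun S => x ∈ S)
  by_cases hx : G.degree x = 1
  · have h2 : (((subtreeFinset G).filter fun S => x ∈ S).erase {x}).card ≤
        ((subtreeFinset G).filter fun S => ¬ x ∈ S).card := by
      refine card_le_card_of_injOn (fun S => S \ {x}) ?_ ?_
      · intro S hS
        obtain ⟨hne, hS⟩ := mem_erase.1 (mem_coe.1 hS)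
        obtain ⟨hS, hxS⟩ := mem_filter.1 hS
        obtain ⟨p, hp, hpx⟩ : ∃ p ∈ S, p ≠ x := by
          by_contra! hcon
          exact hne (eq_singleton_iff_unique_mem.2 ⟨hxS, hcon⟩)
        refine mem_coe.2 (mem_filter.2 ⟨mem_subtreeFinset.2 ?_, by simp⟩)
        exact (mem_subtreeFinset.1 hS).sdiff_leaves hp (by simpa using hpx) (by simpa using hx)
      · intro S hS T hT h
        have hS := (mem_filter.1 (mem_erase.1 (mem_coe.1 hS)).2).2
        have hT := (mem_filter.1 (mem_erase.1 (mem_coe.1 hT)).2).2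
        rw [← insert_erase hS, ← insert_erase hT, erase_eq, erase_eq]
        exact congrArg (insert x) h
    have h4 := Finset.pred_card_le_card_erase (s := (subtreeFinset G).filter fun S => x ∈ S)
      (a := {x})
    simp only [vertexWeight, if_pos hx]
    omega
  · simp only [vertexWeight, if_neg hx]
    omega

theorem sum_vertexWeight_univ :
    ∑ x, G.vertexWeight x = Fintype.card V + G.numNonLeaves := by
  have h := G.numLeaves_add_numNonLeaves
  rw [sum_vertexWeight]
  simp only [numLeaves, numNonLeaves] at *
  omega

theorem IsTree.mul_card_subtreeFinset_le (hG : G.IsTree)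
    (h3 : ∀ x, G.degree x ≠ 1 → 3 ≤ G.degree x) (hk : 1 ≤ G.numNonLeaves)
    (hn : 120 ≤ Fintype.card V) :
    (10 * Fintype.card V + G.numNonLeaves) * (subtreeFinset G).card ≤
      20 * ∑ S ∈ subtreeFinset G, S.card := by
  have h1 := Finset.sum_le_sum fun x (_ : x ∈ univ) => G.vertexWeight_mul_card_le x
  rw [← Finset.sum_mul, Finset.sum_add_distrib, ← Finset.mul_sum, ← sum_card_subtreeFinset,
    sum_vertexWeight_univ] at h1
  have h2 := hG.sum_vertexWeight_mul_card_farSubtrees_le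
  have h4 := hG.sum_innerDarts_le h3 hk hn
  nlinarith

theorem two_mul_sum_card_le :
    2 * ∑ S ∈ subtreeFinset G, S.card ≤
      (Fintype.card V + G.numNonLeaves) * (subtreeFinset G).card + Fintype.card V := by
  have h1 := Finset.sum_le_sum fun x (_ : x ∈ univ) =>
    G.two_mul_card_le_vertexWeight_mul_card_add x
  rw [← Finset.mul_sum, Finset.sum_add_distrib, ← Finset.sum_mul, ← sum_card_subtreeFinset,
    sum_vertexWeight_univ] at h1
  simpa using h1

theorem card_le_card_subtreeFinset : Fintype.card V ≤ (subtreeFinset G).card :=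
  card_le_card_of_injOn (fun x => {x})
    (fun x _ => mem_coe.2 (mem_subtreeFinset.2 (isSubtree_singleton x)))
    (fun _ _ _ _ h => singleton_injective h)

theorem IsTree.le_mu_div (hG : G.IsTree) (h3 : ∀ x, G.degree x ≠ 1 → 3 ≤ G.degree x)
    (hk : 1 ≤ G.numNonLeaves) (hn : 120 ≤ Fintype.card V) :
    1 / 2 + (G.numNonLeaves : ℚ) / Fintype.card V / 20 ≤ mu G / Fintype.card V := by
  have hn0 : (0 : ℚ) < Fintype.card V := by exact_mod_cast (by omega : 0 < Fintype.card V)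
  have hN0 : (0 : ℚ) < (subtreeFinset G).card := by
    have := G.card_le_card_subtreeFinset
    exact_mod_cast (by omega : 0 < (subtreeFinset G).card)
  have h : ((10 * Fintype.card V + G.numNonLeaves) * (subtreeFinset G).card : ℚ) ≤
      20 * ∑ S ∈ subtreeFinset G, (S.card : ℚ) := by
    exact_mod_cast hG.mul_card_subtreeFinset_le h3 hk hn
  have h' : ((10 * Fintype.card V + G.numNonLeaves : ℚ)) / 20 ≤ mu G := by
    rw [mu, le_div_iff₀ hN0]
    linarith
  calc _ = ((10 * Fintype.card V + G.numNonLeaves : ℚ)) / 20 / Fintype.card V := by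
        field_simp
        ring
    _ ≤ _ := by gcongr

theorem mu_div_le (hn : 0 < Fintype.card V) :
    mu G / Fintype.card V ≤
      1 / 2 + (G.numNonLeaves : ℚ) / Fintype.card V / 2 + 1 / Fintype.card V := by
  have hn0 : (0 : ℚ) < Fintype.card V := by exact_mod_cast hn
  have hN : (Fintype.card V : ℚ) ≤ (subtreeFinset G).card := by
    exact_mod_cast G.card_le_card_subtreeFinset
  have hN0 := hn0.trans_le hN
  have h : 2 * ∑ S ∈ subtreeFinset G, (S.card : ℚ) ≤
      (Fintype.card V + G.numNonLeaves) * (subtreeFinset G).card + Fintype.card V := by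
    exact_mod_cast G.two_mul_sum_card_le
  have h' : mu G ≤ (Fintype.card V + G.numNonLeaves : ℚ) / 2 + 1 := by
    rw [mu, div_le_iff₀ hN0]
    linarith
  calc _ ≤ ((Fintype.card V + G.numNonLeaves : ℚ) / 2 + 1) / Fintype.card V := by gcongr
    _ = _ := by
        field_simp

end SimpleGraph

/-- There are only finitely many graphs of bounded order up to isomorphism. -/
theorem SimpleGraph.tendsto_card_atTop_of_not_iso {V : ℕ → Type*} [∀ i, Fintype (V i)]
    (G : ∀ i, SimpleGraph (V i)) (hdist : ∀ i j, i ≠ j → IsEmpty (G i ≃g G j)) :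
    Tendsto (fun i => Fintype.card (V i)) atTop atTop := by
  refine tendsto_atTop.2 fun b => ?_
  rw [← Nat.cofinite_eq_atTop, eventually_cofinite]
  let f : {i | ¬ b ≤ Fintype.card (V i)} → Σ n : Fin b, SimpleGraph (Fin n) := fun i =>
    ⟨⟨Fintype.card (V i), not_le.1 i.2⟩, (G i).overFin rfl⟩
  have hf : Function.Injective f := by
    rintro ⟨i, hi⟩ ⟨j, hj⟩ hij
    by_contra hne
    have hij' : i ≠ j := fun h => hne (Subtype.ext h)
    refine (hdist i j hij').false ?_
    have key : ∀ {x y : Σ n : Fin b, SimpleGraph (Fin n)}, x = y → Nonempty (x.2 ≃g y.2) := by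
      rintro x _ rfl
      exact ⟨Iso.refl⟩
    exact (((G i).overFinIso rfl).trans (key hij).some).trans ((G j).overFinIso rfl).symm
  exact Set.finite_coe_iff.1 (Finite.of_injective f hf)

theorem InT3.three_le_degree {V : Type*} [Fintype V] {G : SimpleGraph V} (h : InT3 G) {x : V}
    (hx : G.degree x ≠ 1) : 3 ≤ G.degree x := by
  obtain ⟨hG, ⟨v, hv⟩, h3⟩ := h
  have : Nontrivial V := by
    obtain ⟨w, hw⟩ := (G.degree_pos_iff_exists_adj v).1 (by omega)
    exact ⟨v, w, hw.ne⟩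
  have := hG.connected.preconnected.degree_pos_of_nontrivial x
  exact h3 x (by omega)

theorem InT3.one_le_numNonLeaves {V : Type*} [Fintype V] {G : SimpleGraph V} (h : InT3 G) :
    1 ≤ G.numNonLeaves := by
  obtain ⟨v, hv⟩ := h.2.1
  exact card_pos.2 ⟨v, mem_filter.2 ⟨mem_univ _, by omega⟩⟩

/-- A sequence of pairwise non-isomorphic trees in 𝒯₃ has average subtree density
tending to `1/2` if and only if the proportion of leaves tends to `1`. -/
theorem density_tendsto_half_iff (V : ℕ → Type) [∀ i, Fintype (V i)]
    (G : ∀ i, SimpleGraph (V i)) (hT : ∀ i, InT3 (G i))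
    (hdist : ∀ i j, i ≠ j → IsEmpty (G i ≃g G j)) :
    Filter.Tendsto (fun i => mu (G i) / (Fintype.card (V i) : ℚ))
        Filter.atTop (nhds (1 / 2)) ↔
      Filter.Tendsto (fun i => (numLeaves (G i) : ℚ) / (Fintype.card (V i) : ℚ))
        Filter.atTop (nhds 1) := by
  have hn := tendsto_card_atTop_of_not_iso G hdist
  have hinv : Tendsto (fun i => 1 / (Fintype.card (V i) : ℚ)) atTop (nhds 0) := by
    simpa only [one_div, Function.comp_def] using
      tendsto_inv_atTop_zero.comp ((tendsto_natCast_atTop_atTop (R := ℚ)).comp hn)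
  have hpos : ∀ᶠ i in atTop, 120 ≤ Fintype.card (V i) := hn.eventually_ge_atTop 120
  set r : ℕ → ℚ := fun i => ((G i).numNonLeaves : ℚ) / Fintype.card (V i) with hr
  have hleaf : (fun i => (numLeaves (G i) : ℚ) / Fintype.card (V i)) =ᶠ[atTop]
      fun i => 1 - r i := by
    filter_upwards [hpos] with i hi
    have h0 : (Fintype.card (V i) : ℚ) ≠ 0 := by exact_mod_cast (by omega : Fintype.card (V i) ≠ 0)
    have h1 : (numLeaves (G i) : ℚ) + (G i).numNonLeaves = Fintype.card (V i) := by
      exact_mod_cast (G i).numLeaves_add_numNonLeaves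
    simp only [hr]
    rw [eq_sub_iff_add_eq, ← add_div, h1, div_self h0]
  have hlow : ∀ᶠ i in atTop, 1 / 2 + r i / 20 ≤ mu (G i) / Fintype.card (V i) :=
    hpos.mono fun i hi => (hT i).1.le_mu_div (fun _ => (hT i).three_le_degree)
      (hT i).one_le_numNonLeaves hi
  have hupp : ∀ᶠ i in atTop, mu (G i) / Fintype.card (V i) ≤
      1 / 2 + r i / 2 + 1 / Fintype.card (V i) :=
    hpos.mono fun i hi => mu_div_le (by omega)
  rw [tendsto_congr' hleaf]
  constructor
  · intro h
    have hr0 : Tendsto r atTop (nhds 0) := by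
      have h20 := (h.sub_const (1 / 2)).const_mul 20
      rw [sub_self, mul_zero] at h20
      refine tendsto_of_tendsto_of_tendsto_of_le_of_le' tendsto_const_nhds h20
        (.of_forall fun i => by positivity) (hlow.mono fun i hi => ?_)
      linarith
    simpa using hr0.const_sub 1
  · intro h
    have hr0 : Tendsto r atTop (nhds 0) := by simpa using h.const_sub 1
    have h1 := (hr0.div_const 20).const_add (1 / 2)
    have h2 := ((hr0.div_const 2).const_add (1 / 2)).add hinv
    simp only [zero_div, add_zero] at h1 h2
    exact tendsto_of_tendsto_of_tendsto_of_le_of_le' h1 h2 hlow hupp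
end

section
/- Let (c_j)_{j≥0} be the sequence of rationals defined by c_j = 1 − (1 + j/2 + Σ_{i=0}^{j−1} c_i)/(2^{j+1} + j) (so c_0 = 1/2). If T is a rooted tree in 𝒯₃* with root v, then λ(T,v) ≥ 1 + Σ_{j≥0} c_j·m_j(T,v). -/
open SimpleGraph Finset BigOperators Filter

attribute [local instance] Classical.propDecidable

/-- The rank of a vertex `w` in the tree `G` rooted at `v`: the maximum length of a
path starting at `w` that does not pass through the parent of `w`. Equivalently
(for a tree), the maximum of `dist w u` over descendants `u` of `w`, i.e. over
those `u` for which `w` lies on the path from `v` to `u`. Leaves have rank `0`. -/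
noncomputable def vrank {V : Type*} [Fintype V] (G : SimpleGraph V) (v w : V) : ℕ :=
  (Finset.univ.filter (fun u => G.dist v u = G.dist v w + G.dist w u)).sup
    (fun u => G.dist w u)

/-- `m_j(G,v)`: the number of non-root vertices of rank `j` in the tree `G` rooted
at `v`. -/
noncomputable def mRank {V : Type*} [Fintype V] (G : SimpleGraph V) (v : V) (j : ℕ) : ℕ :=
  (Finset.univ.filter (fun w => w ≠ v ∧ vrank G v w = j)).card

section RecursiveFamily

variable {V : Type*} {ch : V → Finset V}

theorem exists_children_recursion {α : Type*} [Inhabited α]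
    (hwf : WellFounded fun u w => u ∈ ch w) (step : V → (V → α) → α)
    (hstep : ∀ w f g, (∀ u ∈ ch w, f u = g u) → step w f = step w g) :
    ∃ F : V → α, ∀ w, F w = step w F := by
  refine ⟨hwf.fix fun w rec => step w fun u => if h : u ∈ ch w then rec u h else default, ?_⟩
  intro w
  rw [hwf.fix_eq]
  apply hstep
  intro u hu
  simp [hu]

end RecursiveFamily

section RankCoefficients

variable {c : ℕ → ℚ}

theorem rank_coeff_mem_Icc (hc : ∀ j, c j =
      1 - (1 + (j : ℚ) / 2 + ∑ i ∈ Finset.range j, c i) / (2 ^ (j + 1) + (j : ℚ))) (j : ℕ) :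
    1 / 2 ≤ c j ∧ c j ≤ 1 := by
  induction j using Nat.strong_induction_on with
  | _ j ih =>
    have hlow : 0 ≤ ∑ i ∈ Finset.range j, c i :=
      Finset.sum_nonneg fun i hi => by linarith [(ih i (Finset.mem_range.1 hi)).1]
    have hup : ∑ i ∈ Finset.range j, c i ≤ j := by
      have := Finset.sum_le_card_nsmul (Finset.range j) c 1
        fun i hi => (ih i (Finset.mem_range.1 hi)).2
      simpa using this
    have hpow : (j : ℚ) + 1 ≤ 2 ^ j := by exact_mod_cast Nat.lt_two_pow_self
    have hpos : (0 : ℚ) < 2 ^ (j + 1) + j := by positivity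
    have hj : (0 : ℚ) ≤ j := by positivity
    rw [hc j]
    constructor
    · have : (1 + (j : ℚ) / 2 + ∑ i ∈ Finset.range j, c i) / (2 ^ (j + 1) + (j : ℚ)) ≤ 1 / 2 := by
        rw [div_le_iff₀ hpos, pow_succ]
        linarith
      linarith
    · have : 0 ≤ (1 + (j : ℚ) / 2 + ∑ i ∈ Finset.range j, c i) / (2 ^ (j + 1) + (j : ℚ)) := by
        positivity
      linarith

theorem mul_le_mul_of_leaf_excess {a d b : ℚ} {r x y : ℕ} (hd : d = 2 ^ (r + 1) + r)
    (ha : 1 + (r : ℚ) ≤ a) (hb : b ≤ a + x / 2 + y) (hyx : y ≤ x) (hx : r = 0 → x = 0) {n : ℚ}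
    (hn : (2 : ℚ) ^ (r + 1 + x) + (r + y) ≤ n) : b * d ≤ n * a := by
  have hdpos : 0 < d := by rw [hd]; positivity
  have hapos : 0 < a := by
    have : (0 : ℚ) ≤ r := by positivity
    linarith
  refine (mul_le_mul_of_nonneg_right hb hdpos.le).trans
    (le_trans ?_ (mul_le_mul_of_nonneg_right hn hapos.le))
  rcases Nat.eq_zero_or_pos r with hr | hr
  · obtain rfl := hx hr
    obtain rfl : y = 0 := by omega
    subst hr hd
    norm_num
    linarith
  · have hr1 : (1 : ℚ) ≤ r := by exact_mod_cast hr
    have hyx' : (y : ℚ) ≤ x := by exact_mod_cast hyx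
    have hy : (0 : ℚ) ≤ y := by positivity
    have hpr : (r : ℚ) + 1 ≤ 2 ^ r := by exact_mod_cast Nat.lt_two_pow_self
    have hpx : (x : ℚ) + 1 ≤ 2 ^ x := by exact_mod_cast Nat.lt_two_pow_self
    have hp : (2 : ℚ) ^ (r + 1) * (x + 1) ≤ 2 ^ (r + 1 + x) := by
      rw [pow_add _ (r + 1) x]
      exact mul_le_mul_of_nonneg_left hpx (by positivity)
    have hq : (2 : ℚ) ^ (r + 1) = 2 * 2 ^ r := by ring
    rw [hq] at hd hp
    have hmain : d * ((x : ℚ) / 2 + y) ≤ a * (2 * 2 ^ r * x + y) := by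
      have h1 : 0 ≤ (2 * 2 ^ r * a - d / 2) - (d - a) := by
        rw [hd]
        nlinarith
      have h2 : 0 ≤ 2 * 2 ^ r * a - d / 2 := by
        rw [hd]
        nlinarith
      nlinarith [mul_nonneg h1 hy, mul_nonneg h2 (sub_nonneg.2 hyx')]
    nlinarith [mul_le_mul_of_nonneg_right hp hapos.le]

end RankCoefficients

section BranchingInequality

variable {V : Type*} {ch : V → Finset V}

/-- Lower bound for the number of subtrees through the root in terms of the numbers of leaves
and internal vertices. -/
theorem two_pow_sum_add_sum_le_prod {s : Finset V} {l p : V → ℕ} {N : V → ℚ}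
    (h : ∀ u ∈ s, (2 : ℚ) ^ l u + p u ≤ 1 + N u) :
    (2 : ℚ) ^ (∑ u ∈ s, l u) + ∑ u ∈ s, (p u : ℚ) ≤ ∏ u ∈ s, (1 + N u) := by
  induction s using Finset.induction_on with
  | empty => simp
  | insert a s ha ih =>
    rw [Finset.sum_insert ha, Finset.sum_insert ha, Finset.prod_insert ha, pow_add]
    have h1 := h a (Finset.mem_insert_self a s)
    have h2 := ih fun u hu => h u (Finset.mem_insert_of_mem hu)
    have hp : (0 : ℚ) ≤ p a := by positivity
    have hq : (0 : ℚ) ≤ ∑ u ∈ s, (p u : ℚ) := by positivity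
    have hA : (1 : ℚ) ≤ 2 ^ l a := one_le_pow₀ (by norm_num)
    have hB : (1 : ℚ) ≤ 2 ^ (∑ u ∈ s, l u) := one_le_pow₀ (by norm_num)
    refine le_trans ?_ (mul_le_mul h1 h2 (by positivity) (by linarith))
    nlinarith [mul_nonneg hp hq, mul_nonneg hp (sub_nonneg.2 hB), mul_nonneg hq (sub_nonneg.2 hA)]

theorem one_add_sum_le_of_recursion (hwf : WellFounded fun u w => u ∈ ch w)
    (hch : ∀ w, ch w = ∅ ∨ 2 ≤ (ch w).card) {rk : V → ℕ}
    (hrk : ∀ w, ch w = ∅ → rk w = 0)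
    (hrk' : ∀ w, (ch w).Nonempty → ∃ u ∈ ch w, rk w = rk u + 1)
    {c : ℕ → ℚ} (hc : ∀ j, c j =
      1 - (1 + (j : ℚ) / 2 + ∑ i ∈ Finset.range j, c i) / (2 ^ (j + 1) + (j : ℚ)))
    {N L S : V → ℚ} (hN : ∀ w, N w = ∏ u ∈ ch w, (1 + N u))
    (hL : ∀ w, L w = 1 + ∑ u ∈ ch w, N u / (1 + N u) * L u)
    (hS : ∀ w, S w = c (rk w) + ∑ u ∈ ch w, S u) (w : V) :
    1 + ∑ u ∈ ch w, S u ≤ L w := by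
  obtain ⟨l, hl⟩ := exists_children_recursion hwf
    (fun w (f : V → ℕ) => if ch w = ∅ then 1 else ∑ u ∈ ch w, f u)
    (fun w f g h => by simp only [Finset.sum_congr rfl h])
  obtain ⟨p, hp⟩ := exists_children_recursion hwf
    (fun w (f : V → ℕ) => if ch w = ∅ then 0 else 1 + ∑ u ∈ ch w, f u)
    (fun w f g h => by simp only [Finset.sum_congr rfl h])
  have hcI := rank_coeff_mem_Icc hc
  have hc0 : c 0 = 1 / 2 := by rw [hc 0]; norm_num
  have hpl : ∀ w, p w + 1 ≤ l w := by
    intro w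
    induction w using hwf.induction with
    | _ w ih =>
      rw [hl w, hp w]
      rcases hch w with h | h
      · simp [h]
      · have hne : ch w ≠ ∅ := by
          rintro h'
          simp [h'] at h
        have := Finset.sum_le_sum ih
        rw [Finset.sum_add_distrib] at this
        simp only [Finset.sum_const, smul_eq_mul, mul_one] at this
        simp only [if_neg hne]
        omega
  have hrp : ∀ w, rk w ≤ p w := by
    intro w
    induction w using hwf.induction with
    | _ w ih =>
      rcases (ch w).eq_empty_or_nonempty with h | h
      · simp [hrk w h]
      · obtain ⟨u, hu, hru⟩ := hrk' w h
        rw [hp w, if_neg h.ne_empty, hru]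
        have := Finset.single_le_sum (f := p) (fun _ _ => Nat.zero_le _) hu
        have := ih u hu
        omega
  have hlN : ∀ w, (2 : ℚ) ^ l w + p w ≤ 1 + N w := by
    intro w
    induction w using hwf.induction with
    | _ w ih =>
      rcases (ch w).eq_empty_or_nonempty with h | h
      · rw [hl, hp, hN, h]
        norm_num
      · rw [hl, hp, hN, if_neg h.ne_empty, if_neg h.ne_empty]
        have := two_pow_sum_add_sum_le_prod ih
        push_cast
        linarith
  have hSle : ∀ w, S w ≤
      l w / 2 - 1 / 2 + ∑ i ∈ Finset.range (rk w + 1), c i + (p w - rk w) := by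
    intro w
    induction w using hwf.induction with
    | _ w ih =>
      rcases (ch w).eq_empty_or_nonempty with h | h
      · rw [hl, hp, hS, hrk w h, h]
        norm_num
      · obtain ⟨u, hu, hru⟩ := hrk' w h
        rw [hl, hp, hS, if_neg h.ne_empty, if_neg h.ne_empty, Finset.sum_range_succ,
          ← Finset.add_sum_erase _ S hu, ← Finset.add_sum_erase _ l hu,
          ← Finset.add_sum_erase _ p hu, hru]
        have h1 := ih u hu
        have h2 : ∑ x ∈ (ch w).erase u, S x ≤ ∑ x ∈ (ch w).erase u, ((l x : ℚ) / 2 + p x) := by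
          refine Finset.sum_le_sum fun x hx => ?_
          have h3 := ih x (Finset.mem_of_mem_erase hx)
          have h4 : ∑ i ∈ Finset.range (rk x), c (i + 1) ≤ rk x := by
            have := Finset.sum_le_card_nsmul (Finset.range (rk x)) (fun i => c (i + 1)) 1
              fun i _ => (hcI (i + 1)).2
            simpa using this
          rw [Finset.sum_range_succ', hc0] at h3
          linarith
        rw [Finset.sum_add_distrib, ← Finset.sum_div] at h2
        push_cast
        linarith
  have hratio : ∀ w, (1 + ∑ u ∈ ch w, S u) * (2 ^ (rk w + 1) + (rk w : ℚ)) ≤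
      (1 + N w) * (1 + (rk w : ℚ) / 2 + ∑ i ∈ Finset.range (rk w), c i) := by
    intro w
    have h1 := hpl w
    have h2 := hrp w
    obtain ⟨y, hy⟩ := Nat.exists_eq_add_of_le h2
    obtain ⟨x, hx⟩ := Nat.exists_eq_add_of_le (show rk w + 1 ≤ l w by omega)
    have hSw := hSle w
    rw [hS w, Finset.sum_range_succ] at hSw
    have hNw := hlN w
    rw [hx, hy] at hNw hSw
    push_cast at hNw hSw
    refine mul_le_mul_of_leaf_excess (x := x) (y := y) rfl ?_ ?_ (by omega) ?_ hNw
    · have := Finset.card_nsmul_le_sum (Finset.range (rk w)) c (1 / 2) fun i _ => (hcI i).1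
      simp only [Finset.card_range, nsmul_eq_mul] at this
      linarith
    · linarith
    · intro h0
      rcases (ch w).eq_empty_or_nonempty with h | h
      · have := hl w
        rw [if_pos h] at this
        omega
      · obtain ⟨u, hu, hru⟩ := hrk' w h
        omega
  induction w using hwf.induction with
  | _ w ih =>
    rw [hL w]
    refine add_le_add_right (Finset.sum_le_sum fun u hu => ?_) 1
    have hNpos : 0 < N u := by
      have h1 := hlN u
      have h2 : (2 : ℚ) ^ 1 ≤ 2 ^ l u :=
        pow_le_pow_right₀ (by norm_num) (by have := hpl u; omega)
      have h3 : (0 : ℚ) ≤ p u := by positivity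
      linarith
    have h1 : 0 < 1 + N u := by linarith
    have h2 : (1 + ∑ x ∈ ch u, S x) / (1 + N u) ≤ 1 - c (rk u) := by
      rw [hc (rk u), sub_sub_cancel, div_le_div_iff₀ h1 (by positivity)]
      linarith [hratio u]
    calc S u = c (rk u) + ∑ x ∈ ch u, S x := hS u
      _ ≤ (1 + ∑ x ∈ ch u, S x) - (1 + ∑ x ∈ ch u, S x) / (1 + N u) := by linarith
      _ = N u / (1 + N u) * (1 + ∑ x ∈ ch u, S x) := by field_simp; ring
      _ ≤ N u / (1 + N u) * L u := mul_le_mul_of_nonneg_left (ih u hu) (by positivity)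

end BranchingInequality

section ParentFunction

variable {V : Type*} [Fintype V]

/-- The children of `w` for the parent function `par` and the root `v`. -/
noncomputable def childrenOf (v : V) (par : V → V) (w : V) : Finset V :=
  Finset.univ.filter fun u => u ≠ v ∧ par u = w

/-- The subsets of `U` containing the root `v` and closed under taking parents. -/
noncomputable def parentClosedIn (v : V) (par : V → V) (U : Finset V) : Finset (Finset V) :=
  U.powerset.filter fun s => v ∈ s ∧ ∀ u ∈ s, u ≠ v → par u ∈ s

variable {v : V} {par : V → V}

theorem mem_childrenOf {u w : V} : u ∈ childrenOf v par w ↔ u ≠ v ∧ par u = w := by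
  simp [childrenOf]

theorem wellFounded_childrenOf {dep : V → ℕ} (hdep : ∀ u, u ≠ v → dep u = dep (par u) + 1) :
    WellFounded fun u w => u ∈ childrenOf v par w := by
  have : Std.Irrefl fun a b : V => dep b < dep a := ⟨fun a => lt_irrefl _⟩
  have : IsTrans V fun a b => dep b < dep a := ⟨fun a b d h1 h2 => h2.trans h1⟩
  refine Subrelation.wf (r := fun a b : V => dep b < dep a) ?_
    (Finite.wellFounded_of_trans_of_irrefl _)
  intro a b hab
  obtain ⟨h1, h2⟩ := mem_childrenOf.1 hab
  rw [hdep a h1, h2]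
  exact Nat.lt_succ_self _

theorem sum_childrenOf_root_eq {S a : V → ℚ}
    (hS : ∀ w, S w = a w + ∑ u ∈ childrenOf v par w, S u) :
    ∑ u ∈ childrenOf v par v, S u = ∑ u with u ≠ v, a u := by
  have h1 : ∑ w, ∑ u ∈ childrenOf v par w, S u = ∑ u with u ≠ v, S u := by
    rw [← Finset.sum_fiberwise (Finset.univ.filter fun u => u ≠ v) par S]
    simp only [childrenOf, Finset.filter_filter]
  have h2 : ∑ w, S w = ∑ w, a w + ∑ w, ∑ u ∈ childrenOf v par w, S u := by
    rw [← Finset.sum_add_distrib]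
    exact Finset.sum_congr rfl fun w _ => hS w
  have h3 : ∀ f : V → ℚ, ∑ w, f w = f v + ∑ u with u ≠ v, f u := by
    intro f
    rw [← Finset.add_sum_erase _ f (Finset.mem_univ v)]
    congr 1
    refine Finset.sum_congr ?_ fun _ _ => rfl
    ext u
    simp
  rw [h1, h3 S, h3 a] at h2
  linarith [hS v]

theorem sum_parentClosedIn_insert {U : Finset V} {x : V} (hxv : x ≠ v) (hx : x ∉ U)
    (hpx : par x ≠ x) (hUx : ∀ u ∈ U, u ≠ v → par u ≠ x) (f : Finset V → ℚ) :
    ∑ s ∈ parentClosedIn v par (insert x U), f s =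
      ∑ s ∈ parentClosedIn v par U, (f s + if par x ∈ s then f (insert x s) else 0) := by
  rw [parentClosedIn, parentClosedIn, Finset.sum_filter, Finset.sum_powerset_insert hx,
    Finset.sum_filter, ← Finset.sum_add_distrib]
  refine Finset.sum_congr rfl fun s hs => ?_
  rw [Finset.mem_powerset] at hs
  have hiff : (v ∈ insert x s ∧ ∀ u ∈ insert x s, u ≠ v → par u ∈ insert x s) ↔
      (v ∈ s ∧ ∀ u ∈ s, u ≠ v → par u ∈ s) ∧ par x ∈ s := by
    have hvx : v ≠ x := hxv.symm
    simp only [Finset.mem_insert, hvx, false_or]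
    constructor
    · rintro ⟨h1, h2⟩
      exact ⟨⟨h1, fun u hu huv => (h2 u (Or.inr hu) huv).resolve_left (hUx u (hs hu) huv)⟩,
        (h2 x (Or.inl rfl) hxv).resolve_left hpx⟩
    · rintro ⟨⟨h1, h2⟩, h3⟩
      refine ⟨h1, ?_⟩
      rintro u (rfl | hu) huv
      · exact Or.inr h3
      · exact Or.inr (h2 u hu huv)
  simp only [hiff]
  by_cases h1 : v ∈ s ∧ ∀ u ∈ s, u ≠ v → par u ∈ s
  · by_cases h2 : par x ∈ s
    · simp only [if_pos h1, if_pos h2, if_pos (And.intro h1 h2)]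
    · simp only [if_pos h1, if_neg h2, if_neg fun h : _ ∧ _ => h2 h.2]
  · simp only [if_neg h1, if_neg fun h : _ ∧ _ => h1 h.1, add_zero]

/-- Weighted count and weighted total of the parent-closed subsets of `U`, where every vertex of
`U` carries the weight and the mean size of the branches hanging from it outside `U`. -/
theorem weighted_sum_parentClosedIn {dep : V → ℕ}
    (hdep : ∀ u, u ≠ v → dep u = dep (par u) + 1) {N L : V → ℚ} (hNpos : ∀ w, 0 < N w)
    (hN : ∀ w, N w = ∏ u ∈ childrenOf v par w, (1 + N u))
    (hL : ∀ w, L w = 1 + ∑ u ∈ childrenOf v par w, N u / (1 + N u) * L u)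
    (n : ℕ) (U : Finset V) (hcard : U.card = n) (hv : v ∈ U)
    (hU : ∀ u ∈ U, u ≠ v → par u ∈ U) :
    ∑ s ∈ parentClosedIn v par U, ∏ w ∈ s, ∏ u ∈ childrenOf v par w \ U, (1 + N u) = N v ∧
    ∑ s ∈ parentClosedIn v par U, (∏ w ∈ s, ∏ u ∈ childrenOf v par w \ U, (1 + N u)) *
      ∑ w ∈ s, (1 + ∑ u ∈ childrenOf v par w \ U, N u / (1 + N u) * L u) = N v * L v := by
  induction n generalizing U with
  | zero =>
    rw [Finset.card_eq_zero] at hcard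
    simp [hcard] at hv
  | succ n ih =>
    rcases (U.erase v).eq_empty_or_nonempty with hE | hE
    · have hUv : U = {v} := by
        rw [← Finset.insert_erase hv, hE]
        rfl
      have hcl : parentClosedIn v par {v} = {{v}} := by
        ext s
        simp only [parentClosedIn, Finset.mem_filter, Finset.mem_powerset,
          Finset.subset_singleton_iff, Finset.mem_singleton]
        constructor
        · rintro ⟨rfl | rfl, h, -⟩
          · simp at h
          · rfl
        · rintro rfl
          refine ⟨Or.inr rfl, by simp, ?_⟩
          intro u hu huv
          exact absurd (Finset.mem_singleton.1 hu) huv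
      have hsd : childrenOf v par v \ {v} = childrenOf v par v := by
        rw [Finset.sdiff_eq_self_iff_disjoint, Finset.disjoint_singleton_right, mem_childrenOf]
        exact fun h => h.1 rfl
      subst hUv
      simp only [hcl, Finset.sum_singleton, Finset.prod_singleton, hsd, ← hN, ← hL, and_self]
    · obtain ⟨x, hxE, hmax⟩ := Finset.exists_max_image (U.erase v) dep hE
      obtain ⟨hxv, hxU⟩ := Finset.mem_erase.1 hxE
      obtain ⟨W, hxW, rfl⟩ : ∃ W, x ∉ W ∧ insert x W = U :=
        ⟨U.erase x, Finset.notMem_erase x U, Finset.insert_erase hxU⟩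
      have hparx : ∀ u ∈ insert x W, u ≠ v → par u ≠ x := by
        intro u hu huv h
        have h1 := hmax u (Finset.mem_erase.2 ⟨huv, hu⟩)
        have h2 := hdep u huv
        rw [h] at h2
        omega
      have hpx : par x ≠ x := hparx x hxU hxv
      have hpW : par x ∈ W := Finset.mem_of_mem_insert_of_ne (hU x hxU hxv) hpx
      have hvW : v ∈ W := Finset.mem_of_mem_insert_of_ne hv hxv.symm
      have hWcl : ∀ u ∈ W, u ≠ v → par u ∈ W := fun u hu huv =>
        Finset.mem_of_mem_insert_of_ne (hU u (Finset.mem_insert_of_mem hu) huv)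
          (hparx u (Finset.mem_insert_of_mem hu) huv)
      have hWcard : W.card = n := by
        rw [Finset.card_insert_of_notMem hxW] at hcard
        omega
      obtain ⟨ih1, ih2⟩ := ih W hWcard hvW hWcl
      have hxx : childrenOf v par x \ insert x W = childrenOf v par x := by
        rw [Finset.sdiff_eq_self_iff_disjoint, Finset.disjoint_left]
        intro u hu huW
        obtain ⟨h1, h2⟩ := mem_childrenOf.1 hu
        exact hparx u huW h1 h2
      have hpar : childrenOf v par (par x) \ W =
          insert x (childrenOf v par (par x) \ insert x W) := by
        ext u
        simp only [Finset.mem_sdiff, Finset.mem_insert, mem_childrenOf]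
        by_cases hux : u = x
        · subst hux
          simp [hxv, hxW]
        · simp [hux]
      have hnot : x ∉ childrenOf v par (par x) \ insert x W := by simp
      have hother : ∀ w, w ≠ par x →
          childrenOf v par w \ W = childrenOf v par w \ insert x W := by
        intro w hw
        ext u
        simp only [Finset.mem_sdiff, Finset.mem_insert, mem_childrenOf]
        by_cases hux : u = x
        · subst hux
          simp [hw.symm]
        · simp [hux]
      have hprod : ∀ s : Finset V, ∏ w ∈ s, ∏ u ∈ childrenOf v par w \ W, (1 + N u) =
          (if par x ∈ s then 1 + N x else 1) *
            ∏ w ∈ s, ∏ u ∈ childrenOf v par w \ insert x W, (1 + N u) := by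
        intro s
        have h1 : ∀ w, ∏ u ∈ childrenOf v par w \ W, (1 + N u) =
            (if par x = w then 1 + N x else 1) *
              ∏ u ∈ childrenOf v par w \ insert x W, (1 + N u) := by
          intro w
          by_cases hw : par x = w
          · subst hw
            rw [if_pos rfl, hpar, Finset.prod_insert hnot]
          · rw [if_neg hw, one_mul, hother w (Ne.symm hw)]
        simp only [h1, Finset.prod_mul_distrib, Finset.prod_ite_eq]
      have hsum : ∀ s : Finset V,
          ∑ w ∈ s, (1 + ∑ u ∈ childrenOf v par w \ W, N u / (1 + N u) * L u) =
          (if par x ∈ s then N x / (1 + N x) * L x else 0) +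
            ∑ w ∈ s, (1 + ∑ u ∈ childrenOf v par w \ insert x W, N u / (1 + N u) * L u) := by
        intro s
        have h1 : ∀ w, 1 + ∑ u ∈ childrenOf v par w \ W, N u / (1 + N u) * L u =
            (if par x = w then N x / (1 + N x) * L x else 0) +
              (1 + ∑ u ∈ childrenOf v par w \ insert x W, N u / (1 + N u) * L u) := by
          intro w
          by_cases hw : par x = w
          · subst hw
            rw [if_pos rfl, hpar, Finset.sum_insert hnot]
            ring
          · rw [if_neg hw, zero_add, hother w (Ne.symm hw)]
        simp only [h1]
        rw [Finset.sum_add_distrib, Finset.sum_ite_eq]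
      have hxs : ∀ s ∈ parentClosedIn v par W, x ∉ s := fun s hs hx =>
        hxW (Finset.mem_powerset.1 (Finset.mem_filter.1 hs).1 hx)
      have hne : 1 + N x ≠ 0 := by
        have := hNpos x
        positivity
      rw [sum_parentClosedIn_insert hxv hxW hpx
          (fun u hu => hparx u (Finset.mem_insert_of_mem hu)),
        sum_parentClosedIn_insert hxv hxW hpx
          (fun u hu => hparx u (Finset.mem_insert_of_mem hu)), ← ih2, ← ih1]
      constructor
      · refine Finset.sum_congr rfl fun s hs => ?_
        rw [hprod, Finset.prod_insert (hxs s hs), hxx, ← hN]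
        split_ifs <;> ring
      · refine Finset.sum_congr rfl fun s hs => ?_
        rw [hprod, hsum, Finset.prod_insert (hxs s hs), Finset.sum_insert (hxs s hs), hxx, ← hN,
          ← hL]
        split_ifs
        · field_simp
          ring
        · ring

end ParentFunction

section RootedTree

variable {V : Type*} {G : SimpleGraph V}

theorem SimpleGraph.IsTree.eq_penultimate_of_isPath (hG : G.IsTree) {v u w : V}
    (hwu : G.Adj w u) (hd : G.dist v u = G.dist v w + 1) {p : G.Walk v u} (hp : p.IsPath) :
    w = p.penultimate := by
  obtain ⟨q, hq⟩ := hG.connected.exists_walk_length_eq_dist v w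
  have hq' : (q.concat hwu).IsPath := by
    apply SimpleGraph.Walk.isPath_of_length_eq_dist
    rw [SimpleGraph.Walk.length_concat, hq, hd]
  rw [(hG.existsUnique_path v u).unique hp hq', SimpleGraph.Walk.penultimate_concat]

theorem SimpleGraph.Connected.exists_adj_dist_eq_add_one (hG : G.Connected) {v u : V}
    (h : u ≠ v) : ∃ w, G.Adj u w ∧ G.dist u v = G.dist w v + 1 := by
  obtain ⟨q, hq⟩ := hG.exists_walk_length_eq_dist u v
  cases q with
  | nil => exact absurd rfl h
  | @cons _ w _ hadj q =>
    refine ⟨w, hadj, ?_⟩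
    rw [SimpleGraph.Walk.length_cons] at hq
    have h1 := G.dist_le q
    have h2 := hG.dist_triangle (u := u) (v := w) (w := v)
    rw [SimpleGraph.dist_eq_one_iff_adj.2 hadj] at h2
    omega

theorem SimpleGraph.IsTree.exists_parent (hG : G.IsTree) (v : V) :
    ∃ par : V → V, ∀ u, u ≠ v → ∀ w, par u = w ↔ G.Adj w u ∧ G.dist v u = G.dist v w + 1 := by
  have hex : ∀ u, ∃ x, u ≠ v → G.Adj x u ∧ G.dist v u = G.dist v x + 1 := by
    intro u
    by_cases h : u = v
    · exact ⟨v, fun h' => absurd h h'⟩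
    · obtain ⟨w, h1, h2⟩ := hG.connected.exists_adj_dist_eq_add_one h
      exact ⟨w, fun _ => ⟨h1.symm, by rw [G.dist_comm, h2, G.dist_comm]⟩⟩
  choose par hpar using hex
  refine ⟨par, fun u hu w => ⟨?_, fun h => ?_⟩⟩
  · rintro rfl
    exact hpar u hu
  · obtain ⟨p, hp, -⟩ := hG.existsUnique_path v u
    rw [hG.eq_penultimate_of_isPath (hpar u hu).1 (hpar u hu).2 hp,
      hG.eq_penultimate_of_isPath h.1 h.2 hp]

theorem SimpleGraph.IsTree.isSubtree_iff (hG : G.IsTree) {v : V} {par : V → V}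
    (hpar : ∀ u, u ≠ v → ∀ w, par u = w ↔ G.Adj w u ∧ G.dist v u = G.dist v w + 1)
    {s : Finset V} (hv : v ∈ s) : G.IsSubtree s ↔ ∀ u ∈ s, u ≠ v → par u ∈ s := by
  constructor
  · rintro ⟨-, hs⟩ u hu huv
    obtain ⟨p, hp⟩ := (hs.preconnected ⟨v, hv⟩ ⟨u, hu⟩).exists_isPath
    have hp' : (p.map (SimpleGraph.Embedding.induce (s : Set V)).toHom).IsPath :=
      hp.map Subtype.val_injective
    obtain ⟨h1, h2⟩ := (hpar u huv _).1 rfl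
    have h3 := hG.eq_penultimate_of_isPath h1 h2 hp'
    have h4 : par u ∈ (p.map (SimpleGraph.Embedding.induce (s : Set V)).toHom).support :=
      h3 ▸ SimpleGraph.Walk.getVert_mem_support _ _
    rw [SimpleGraph.Walk.support_map, List.mem_map] at h4
    obtain ⟨y, -, hy⟩ := h4
    rw [← hy]
    exact y.2
  · intro hs
    refine ⟨⟨v, hv⟩, (SimpleGraph.connected_iff_exists_forall_reachable _).2 ⟨⟨v, hv⟩, ?_⟩⟩
    have hreach : ∀ n u (hu : u ∈ s), G.dist v u = n →
        (G.induce (s : Set V)).Reachable ⟨v, hv⟩ ⟨u, hu⟩ := by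
      intro n
      induction n with
      | zero =>
        intro u hu h
        obtain rfl := hG.connected.dist_eq_zero_iff.1 h
        exact SimpleGraph.Reachable.refl _
      | succ n ih =>
        intro u hu h
        have huv : u ≠ v := by
          rintro rfl
          simp at h
        obtain ⟨h1, h2⟩ := (hpar u huv _).1 rfl
        refine (ih (par u) (hs u hu huv) (by omega)).trans (SimpleGraph.Adj.reachable ?_)
        exact h1
    rintro ⟨u, hu⟩
    exact hreach _ u hu rfl

theorem SimpleGraph.Connected.exists_child_of_descendant (hG : G.Connected) {v w x : V}
    (hx : G.dist v x = G.dist v w + G.dist w x) (hne : w ≠ x) :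
    ∃ u, G.Adj w u ∧ G.dist v u = G.dist v w + 1 ∧
      G.dist v x = G.dist v u + G.dist u x ∧ G.dist w x = G.dist u x + 1 := by
  obtain ⟨u, h1, h2⟩ := hG.exists_adj_dist_eq_add_one hne
  have h3 := hG.dist_triangle (u := v) (v := w) (w := u)
  rw [SimpleGraph.dist_eq_one_iff_adj.2 h1] at h3
  have h4 := hG.dist_triangle (u := v) (v := u) (w := x)
  exact ⟨u, h1, by omega, by omega, h2⟩

theorem SimpleGraph.Connected.descendant_of_child (hG : G.Connected) {v w u x : V}
    (hwu : G.Adj w u) (hd : G.dist v u = G.dist v w + 1)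
    (hx : G.dist v x = G.dist v u + G.dist u x) :
    G.dist v x = G.dist v w + G.dist w x ∧ G.dist w x = G.dist u x + 1 := by
  have h1 := hG.dist_triangle (u := w) (v := u) (w := x)
  rw [SimpleGraph.dist_eq_one_iff_adj.2 hwu] at h1
  have h2 := hG.dist_triangle (u := v) (v := w) (w := x)
  omega

variable [Fintype V]

theorem vrank_lt_card (hG : G.Connected) (v w : V) : vrank G v w < Fintype.card V := by
  have := hG.nonempty
  rw [vrank, Finset.sup_lt_iff (by simpa using Fintype.card_pos)]
  intro u _
  obtain ⟨p, hp, hlen⟩ := hG.exists_path_of_dist w u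
  rw [← hlen]
  exact hp.length_lt

theorem sum_coeff_mul_mRank (hG : G.Connected) (v : V) (c : ℕ → ℚ) :
    ∑ j ∈ Finset.range (Fintype.card V), c j * (mRank G v j : ℚ) =
      ∑ u with u ≠ v, c (vrank G v u) := by
  rw [← Finset.sum_fiberwise_of_maps_to (t := Finset.range (Fintype.card V)) (g := vrank G v)
    fun u _ => Finset.mem_range.2 (vrank_lt_card hG v u)]
  refine Finset.sum_congr rfl fun j _ => ?_
  rw [mRank, Finset.filter_filter, Finset.sum_congr rfl (g := fun _ => c j), Finset.sum_const,
    nsmul_eq_mul, mul_comm]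
  intro u hu
  rw [(Finset.mem_filter.1 hu).2.2]

theorem dist_le_vrank {v w x : V} (hx : G.dist v x = G.dist v w + G.dist w x) :
    G.dist w x ≤ vrank G v w :=
  Finset.le_sup (f := fun u => G.dist w u) (Finset.mem_filter.2 ⟨Finset.mem_univ x, hx⟩)

theorem exists_dist_eq_vrank (v w : V) :
    ∃ x, G.dist v x = G.dist v w + G.dist w x ∧ vrank G v w = G.dist w x := by
  obtain ⟨x, hx, h⟩ := Finset.exists_mem_eq_sup
    (Finset.univ.filter fun u => G.dist v u = G.dist v w + G.dist w u)
    ⟨w, by simp⟩ (fun u => G.dist w u)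
  exact ⟨x, (Finset.mem_filter.1 hx).2, h⟩

theorem vrank_eq_zero (hG : G.Connected) {v w : V}
    (h : ∀ u, ¬ (G.Adj w u ∧ G.dist v u = G.dist v w + 1)) : vrank G v w = 0 := by
  obtain ⟨x, hx, hr⟩ := exists_dist_eq_vrank (G := G) v w
  by_cases hne : w = x
  · rw [hr, hne, SimpleGraph.dist_self]
  · obtain ⟨u, h1, h2, -⟩ := hG.exists_child_of_descendant hx hne
    exact absurd ⟨h1, h2⟩ (h u)

theorem exists_child_vrank_eq_add_one (hG : G.Connected) {v w u : V} (hwu : G.Adj w u)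
    (hd : G.dist v u = G.dist v w + 1) :
    ∃ y, G.Adj w y ∧ G.dist v y = G.dist v w + 1 ∧ vrank G v w = vrank G v y + 1 := by
  have hle : ∀ y, G.Adj w y → G.dist v y = G.dist v w + 1 → vrank G v y + 1 ≤ vrank G v w := by
    intro y h1 h2
    obtain ⟨x, hx, hr⟩ := exists_dist_eq_vrank (G := G) v y
    obtain ⟨h3, h4⟩ := hG.descendant_of_child h1 h2 hx
    rw [hr, ← h4]
    exact dist_le_vrank h3
  obtain ⟨x, hx, hr⟩ := exists_dist_eq_vrank (G := G) v w
  have hne : w ≠ x := by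
    rintro rfl
    have := hle u hwu hd
    rw [hr, SimpleGraph.dist_self] at this
    omega
  obtain ⟨y, h1, h2, h3, h4⟩ := hG.exists_child_of_descendant hx hne
  have h5 := hle y h1 h2
  have h6 := dist_le_vrank h3
  exact ⟨y, h1, h2, by omega⟩

theorem InT3Star.card_children {v : V} (h : InT3Star G v) {par : V → V}
    (hpar : ∀ u, u ≠ v → ∀ w, par u = w ↔ G.Adj w u ∧ G.dist v u = G.dist v w + 1) (w : V) :
    childrenOf v par w = ∅ ∨ 2 ≤ (childrenOf v par w).card := by
  obtain ⟨hG, hcard | ⟨hroot, hdeg3⟩⟩ := h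
  · left
    obtain ⟨x, hx⟩ := Fintype.card_eq_one_iff.1 hcard
    ext u
    simp [mem_childrenOf, hx u, hx v]
  · have hmem : ∀ u, u ∈ childrenOf v par w ↔ G.Adj w u ∧ G.dist v u = G.dist v w + 1 := by
      intro u
      rw [mem_childrenOf]
      constructor
      · rintro ⟨h1, h2⟩
        exact (hpar u h1 w).1 h2
      · intro h1
        have huv : u ≠ v := by
          rintro rfl
          simp at h1
        exact ⟨huv, (hpar u huv w).2 h1⟩
    by_cases hw : w = v
    · right
      subst hw
      rw [← SimpleGraph.card_neighborFinset_eq_degree] at hroot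
      refine hroot.trans (Finset.card_le_card fun u hu => (hmem u).2 ?_)
      rw [SimpleGraph.mem_neighborFinset] at hu
      exact ⟨hu, by rw [SimpleGraph.dist_eq_one_iff_adj.2 hu, SimpleGraph.dist_self]⟩
    · obtain ⟨hp1, hp2⟩ := (hpar w hw _).1 rfl
      have hnb : G.neighborFinset w = insert (par w) (childrenOf v par w) := by
        ext u
        rw [SimpleGraph.mem_neighborFinset, Finset.mem_insert, hmem]
        constructor
        · intro hu
          rcases hG.dist_eq_dist_add_one_of_adj v hu with h1 | h1
          · exact Or.inl ((hpar w hw u).2 ⟨hu.symm, h1⟩).symm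
          · exact Or.inr ⟨hu, h1⟩
        · rintro (rfl | hu)
          · exact hp1.symm
          · exact hu.1
      have hdeg : G.degree w = (childrenOf v par w).card + 1 := by
        rw [← SimpleGraph.card_neighborFinset_eq_degree, hnb, Finset.card_insert_of_notMem]
        intro hmem'
        have := ((hmem _).1 hmem').2
        omega
      rcases (childrenOf v par w).eq_empty_or_nonempty with h0 | h0
      · exact Or.inl h0
      · right
        have h1 := h0.card_pos
        have h2 := hdeg3 w hw (by omega)
        omega

end RootedTree

/-- Let `(c_j)` be defined by `c_j = 1 - (1 + j/2 + ∑_{i<j} c_i)/(2^(j+1) + j)`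
(so `c_0 = 1/2`). If `T ∈ 𝒯₃*` has root `v` then
`λ(T,v) ≥ 1 + ∑_j c_j · m_j(T,v)`. The sum is finite: every vertex has rank less
than the number of vertices, so `m_j(T,v) = 0` for `j ≥ n` and it suffices to sum
over `j < n`. -/
theorem lambda_ge_one_add_sum_rank {V : Type*} [Fintype V] (G : SimpleGraph V)
    (v : V) (h : InT3Star G v) (c : ℕ → ℚ)
    (hc : ∀ j, c j =
      1 - (1 + (j : ℚ) / 2 + ∑ i ∈ Finset.range j, c i) / (2 ^ (j + 1) + (j : ℚ))) :
    1 + ∑ j ∈ Finset.range (Fintype.card V), c j * (mRank G v j : ℚ) ≤ lambdaV G v := by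
  have hG := h.1
  have hconn := hG.connected
  obtain ⟨par, hpar⟩ := hG.exists_parent v
  have hdep : ∀ u, u ≠ v → G.dist v u = G.dist v (par u) + 1 :=
    fun u hu => ((hpar u hu _).1 rfl).2
  have hwf := wellFounded_childrenOf hdep
  have hmem : ∀ {u w}, G.Adj w u → G.dist v u = G.dist v w + 1 → u ∈ childrenOf v par w := by
    intro u w h1 h2
    have huv : u ≠ v := by
      rintro rfl
      simp at h2
    exact mem_childrenOf.2 ⟨huv, (hpar u huv w).2 ⟨h1, h2⟩⟩
  obtain ⟨N, hN⟩ := exists_children_recursion hwf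
    (fun w (f : V → ℚ) => ∏ u ∈ childrenOf v par w, (1 + f u))
    (fun w f g h => Finset.prod_congr rfl fun u hu => by rw [h u hu])
  obtain ⟨L, hL⟩ := exists_children_recursion hwf
    (fun w (f : V → ℚ) => 1 + ∑ u ∈ childrenOf v par w, N u / (1 + N u) * f u)
    (fun w f g h => congrArg _ (Finset.sum_congr rfl fun u hu => by rw [h u hu]))
  obtain ⟨S, hS⟩ := exists_children_recursion hwf
    (fun w (f : V → ℚ) => c (vrank G v w) + ∑ u ∈ childrenOf v par w, f u)
    (fun w f g h => congrArg _ (Finset.sum_congr rfl h))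
  have hNpos : ∀ w, 0 < N w := by
    intro w
    induction w using hwf.induction with
    | _ w ih =>
      rw [hN w]
      exact Finset.prod_pos fun u hu => by linarith [ih u hu]
  have hclosed : (subtreeFinset G).filter (fun s => v ∈ s) =
      parentClosedIn v par Finset.univ := by
    ext s
    simp only [subtreeFinset, parentClosedIn, Finset.mem_filter, Finset.mem_univ, true_and,
      Finset.powerset_univ]
    rw [and_comm]
    exact and_congr_right fun hv => hG.isSubtree_iff hpar hv
  obtain ⟨hcount, htotal⟩ := weighted_sum_parentClosedIn hdep hNpos hN hL _ Finset.univ rfl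
    (Finset.mem_univ v) (fun _ _ _ => Finset.mem_univ _)
  have hsd : ∀ A : Finset V, A \ Finset.univ = ∅ := fun A =>
    Finset.sdiff_eq_empty_iff_subset.2 (Finset.subset_univ A)
  simp only [hsd, Finset.prod_empty, Finset.sum_empty, Finset.prod_const_one, add_zero, one_mul,
    Finset.sum_const, nsmul_eq_mul, mul_one] at hcount htotal
  have hlam : lambdaV G v = L v := by
    rw [lambdaV, hclosed, htotal, hcount, mul_div_cancel_left₀ _ (hNpos v).ne']
  rw [hlam, sum_coeff_mul_mRank hconn, ← sum_childrenOf_root_eq hS]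
  refine one_add_sum_le_of_recursion hwf (h.card_children hpar) (rk := vrank G v) ?_ ?_ hc
    hN hL hS v
  · intro w hw
    refine vrank_eq_zero hconn fun u hu => ?_
    have := hmem hu.1 hu.2
    simp [hw] at this
  · rintro w ⟨u, hu⟩
    obtain ⟨h1, h2⟩ := mem_childrenOf.1 hu
    obtain ⟨h3, h4⟩ := (hpar u h1 w).1 h2
    obtain ⟨y, hy1, hy2, hy3⟩ := exists_child_vrank_eq_add_one hconn h3 h4
    exact ⟨y, hmem hy1 hy2, hy3⟩
end

section
/- Let (c_j)_{j≥0} be the sequence defined by c_j = 1 − (1 + j/2 + Σ_{i=0}^{j−1} c_i)/(2^{j+1} + j) (so c_0 = 1/2). Then for every j ≥ 0, 1 − (1 + 3j/2)/(2^{j+1} + j) ≤ c_j ≤ 1 − (1 + j)/(2^{j+1} + j); in particular 1/2 ≤ c_j ≤ 1 for all j, the sequence (c_j) is nondecreasing, and c_j → 1 as j → ∞. -/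
open Finset Filter

theorem quadratic_le_two_mul_two_pow_succ (j : ℕ) :
    (j : ℚ) ^ 2 + 3 * j + 4 ≤ 2 * 2 ^ (j + 1) := by
  induction j with
  | zero => norm_num
  | succ k ih =>
    have hk : (0 : ℚ) ≤ k := k.cast_nonneg
    rw [pow_succ _ (k + 1)]
    push_cast
    nlinarith

/-- Let `(c_j)` be the sequence of rationals defined by
`c_j = 1 - (1 + j/2 + ∑_{i<j} c_i)/(2^(j+1) + j)` (so `c_0 = 1/2`). Then for every
`j`, `1 - (1 + 3j/2)/(2^(j+1) + j) ≤ c_j ≤ 1 - (1 + j)/(2^(j+1) + j)`; in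
particular `1/2 ≤ c_j ≤ 1` for all `j`, the sequence is nondecreasing, and
`c_j → 1`. -/
theorem c_seq_bounds (c : ℕ → ℚ)
    (hc : ∀ j, c j =
      1 - (1 + (j : ℚ) / 2 + ∑ i ∈ Finset.range j, c i) / (2 ^ (j + 1) + (j : ℚ))) :
    (∀ j : ℕ, 1 - (1 + 3 * (j : ℚ) / 2) / (2 ^ (j + 1) + (j : ℚ)) ≤ c j ∧
        c j ≤ 1 - (1 + (j : ℚ)) / (2 ^ (j + 1) + (j : ℚ))) ∧
      (∀ j, 1 / 2 ≤ c j ∧ c j ≤ 1) ∧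
      Monotone c ∧
      Filter.Tendsto c Filter.atTop (nhds 1) := by
  have hD (j : ℕ) : (0 : ℚ) < 2 ^ (j + 1) + (j : ℚ) := by positivity
  have half_le_of_sum (j : ℕ) (h : ∑ i ∈ range j, c i ≤ j) : 1 / 2 ≤ c j := by
    have hq := quadratic_le_two_mul_two_pow_succ j
    have hsq : (j : ℚ) ≤ (j : ℚ) ^ 2 := by exact_mod_cast Nat.le_self_pow two_ne_zero j
    have : (1 + (j : ℚ) / 2 + ∑ i ∈ range j, c i) / (2 ^ (j + 1) + (j : ℚ)) ≤ 1 / 2 := by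
      rw [div_le_iff₀ (hD j)]
      linarith
    rw [hc j]
    linarith
  have le_one_of_sum (j : ℕ) (h : (j : ℚ) / 2 ≤ ∑ i ∈ range j, c i) : c j ≤ 1 := by
    have hj : (0 : ℚ) ≤ j := j.cast_nonneg
    rw [hc j]
    exact sub_le_self _ (div_nonneg (by linarith) (hD j).le)
  have hS (j : ℕ) : (j : ℚ) / 2 ≤ ∑ i ∈ range j, c i ∧ ∑ i ∈ range j, c i ≤ j := by
    induction j with
    | zero => simp
    | succ k ih =>
      have h₁ := half_le_of_sum k ih.2
      have h₂ := le_one_of_sum k ih.1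
      rw [sum_range_succ]
      push_cast
      constructor <;> linarith [ih.1, ih.2]
  have hbounds (j : ℕ) : 1 - (1 + 3 * (j : ℚ) / 2) / (2 ^ (j + 1) + (j : ℚ)) ≤ c j ∧
      c j ≤ 1 - (1 + (j : ℚ)) / (2 ^ (j + 1) + (j : ℚ)) := by
    rw [hc j]
    have hDj := (hD j).le
    constructor <;> refine sub_le_sub_left (div_le_div_of_nonneg_right ?_ hDj) 1 <;>
      linarith [(hS j).1, (hS j).2]
  have hone (j : ℕ) : c j ≤ 1 := le_one_of_sum j (hS j).1
  refine ⟨hbounds, fun j => ⟨half_le_of_sum j (hS j).2, hone j⟩,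
    monotone_nat_of_le_succ fun j => ?_, ?_⟩
  · have hj : (0 : ℚ) ≤ j := j.cast_nonneg
    have hcj : (1 - c j) * (2 ^ (j + 1) + (j : ℚ)) = 1 + (j : ℚ) / 2 + ∑ i ∈ range j, c i := by
      rw [hc j, sub_sub_cancel, div_mul_cancel₀ _ (hD j).ne']
    have hgap : 3 / 2 ≤ (1 - c j) * (2 ^ (j + 1) + 2) := by
      have hub := sub_le_sub_left (hbounds j).2 1
      rw [sub_sub_cancel] at hub
      refine le_trans ?_ (mul_le_mul_of_nonneg_right hub (by positivity))
      rw [div_mul_eq_mul_div, le_div_iff₀ (hD j)]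
      rcases Nat.eq_zero_or_pos j with rfl | hpos
      · norm_num
      · have h1 : (1 : ℚ) ≤ j := by exact_mod_cast hpos
        have hP : (0 : ℚ) < 2 ^ (j + 1) := by positivity
        nlinarith [mul_nonneg (sub_nonneg.2 h1) hP.le]
    rw [hc (j + 1), le_sub_comm, div_le_iff₀ (hD (j + 1)), sum_range_succ, pow_succ _ (j + 1)]
    push_cast
    linarith
  · have hlim : Tendsto (fun j : ℕ => 1 - 3 * (1 / ((j : ℚ) + 1))) atTop (nhds 1) := by
      simpa using (tendsto_one_div_add_atTop_nhds_zero_nat (𝕜 := ℚ)).const_mul 3 |>.const_sub 1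
    refine tendsto_of_tendsto_of_tendsto_of_le_of_le hlim tendsto_const_nhds (fun j => ?_) hone
    refine le_trans (sub_le_sub_left ?_ 1) (hbounds j).1
    have hj : (0 : ℚ) ≤ j := j.cast_nonneg
    rw [mul_one_div, div_le_div_iff₀ (hD j) (by positivity)]
    nlinarith [quadratic_le_two_mul_two_pow_succ j]
end
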